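/- arXiv:2601.17852 — 2 statements merged into one kernel-verified Lean document; each statement's English description precedes it below -/
import Mathlib

section
/- Let Σ ⊂ ℙ^{r−1} be a non-degenerate integral projective curve of degree s and arithmetic genus π, with r − 1 ≥ 3 and s ≥ r − 1. Then π < (s−1 choose 2), and consequently for every d > 0 and every s ≥ 2, (d/(2s))(2π − 2 − s) < (d/2)(s − 4). -/
open MvPolynomial

attribute [local instance] MvPolynomial.gradedAlgebra

/-- Hilbert function of the subscheme of projective space cut out by the homogeneous
ideal `I`: dimension of the degree-`i` piece of the homogeneous coordinate ring. -/
noncomputable def hilb {m : ℕ} (I : Ideal (MvPolynomial (Fin m) ℂ)) (i : ℕ) : ℕ :=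
  Module.finrank ℂ
    ((MvPolynomial.homogeneousSubmodule (Fin m) ℂ i).map
      (Ideal.Quotient.mkₐ ℂ I).toLinearMap)

theorem comp_mul {r : ℕ} {m : MvPolynomial (Fin r) ℂ} (hm : m.IsHomogeneous 1) (n : ℕ)
    (k : MvPolynomial (Fin r) ℂ) :
    homogeneousComponent (n + 1) (m * k) = m * homogeneousComponent n k := by
  conv_lhs => rw [← sum_homogeneousComponent k]
  rw [Finset.mul_sum, map_sum]
  have : ∀ i, homogeneousComponent (n + 1) (m * homogeneousComponent i k) =
      if i = n then m * homogeneousComponent n k else 0 := by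
    intro i
    have h := hm.mul (homogeneousComponent_isHomogeneous i k)
    rw [homogeneousComponent_of_mem ((mem_homogeneousSubmodule _ _).2 h)]
    by_cases h : i = n
    · subst h; simp [add_comm]
    · rw [if_neg (by omega), if_neg h]
  simp only [this]
  rw [Finset.sum_ite_eq']
  split_ifs with h
  · rfl
  · rw [homogeneousComponent_eq_zero _ _ (by simpa using h), mul_zero]

theorem exists_m {r : ℕ} (J : Ideal (MvPolynomial (Fin r) ℂ))
    (hJ : J.IsHomogeneous (MvPolynomial.homogeneousSubmodule (Fin r) ℂ)) :
    ∃ m : MvPolynomial (Fin r) ℂ, m.IsHomogeneous 1 ∧ ∃ N : ℕ, ∀ n ≥ N,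
      ∀ p : MvPolynomial (Fin r) ℂ, p.IsHomogeneous n → m * p ∈ J → p ∈ J := by
  classical
  have hfin := associatedPrimes.finite (MvPolynomial (Fin r) ℂ) (MvPolynomial (Fin r) ℂ ⧸ J)
  let V := homogeneousSubmodule (Fin r) ℂ 1
  let res : Ideal (MvPolynomial (Fin r) ℂ) → Submodule ℂ V :=
    fun p => (p.restrictScalars ℂ).comap V.subtype
  let s : Finset (Submodule ℂ V) := (hfin.toFinset.image res).erase ⊤
  have hs : ⊤ ∉ s := by simp [s]
  have hne := Subspace.biUnion_ne_univ_of_top_notMem hs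
  obtain ⟨m, hm⟩ := (Set.ne_univ_iff_exists_notMem _).1 hne
  have hm' : ∀ p ∈ associatedPrimes (MvPolynomial (Fin r) ℂ) (MvPolynomial (Fin r) ℂ ⧸ J),
      m.1 ∈ p → ∀ i, (X i : MvPolynomial (Fin r) ℂ) ∈ p := by
    intro p hp hmp i
    by_contra hi
    apply hm
    simp only [Set.mem_iUnion]
    refine ⟨res p, ?_, hmp⟩
    rw [Finset.mem_erase]
    refine ⟨?_, Finset.mem_image_of_mem _ (by simpa using hp)⟩
    intro htop
    have : (⟨X i, (mem_homogeneousSubmodule _ _).2 (isHomogeneous_X ℂ i)⟩ : V) ∈ res p := by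
      rw [htop]; trivial
    exact hi this
  let K' : Submodule (MvPolynomial (Fin r) ℂ) (MvPolynomial (Fin r) ℂ ⧸ J) :=
    LinearMap.ker (LinearMap.lsmul (MvPolynomial (Fin r) ℂ) (MvPolynomial (Fin r) ℂ ⧸ J) m.1)
  have hrad : idealOfVars (Fin r) ℂ ≤ (Module.annihilator (MvPolynomial (Fin r) ℂ) K').radical := by
    rw [← Ideal.sInf_minimalPrimes]
    refine le_sInf fun p hp => ?_
    have hmp : m.1 ∈ p := by
      apply hp.1.2
      rw [Module.mem_annihilator]
      rintro ⟨k, hk⟩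
      exact Subtype.ext hk
    have hp2 := Module.associatedPrimes.minimalPrimes_annihilator_subset_associatedPrimes _ _ hp
    have hp3 := associatedPrimes.subset_of_injective (f := K'.subtype) K'.injective_subtype hp2
    refine Ideal.span_le.2 ?_
    rintro _ ⟨i, rfl⟩
    exact hm' p hp3 hmp i
  obtain ⟨N, hN⟩ := Ideal.exists_pow_le_of_le_radical_of_fg hrad (idealOfVars_fg _ _)
  have hmhom : m.1.IsHomogeneous 1 := m.2
  have kill : ∀ k : MvPolynomial (Fin r) ℂ, m.1 * k ∈ J → ∀ a ≥ N, ∀ c : MvPolynomial (Fin r) ℂ,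
      c.IsHomogeneous a → c * k ∈ J := by
    intro k hk a ha c hc
    have hc' : c ∈ idealOfVars (Fin r) ℂ ^ N := by
      rw [mem_pow_idealOfVars_iff]
      intro x hx
      have := hc (mem_support_iff.1 hx)
      have this : Finsupp.degree x = a := by rw [Finsupp.degree_eq_weight_one]; exact this
      omega
    have h2 := Module.mem_annihilator.1 (hN hc') ⟨Ideal.Quotient.mk J k, by
      change Ideal.Quotient.mk J (m.1 * k) = 0
      exact Ideal.Quotient.eq_zero_iff_mem.2 hk⟩
    have h3 : Ideal.Quotient.mk J (c * k) = 0 := congrArg Subtype.val h2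
    exact Ideal.Quotient.eq_zero_iff_mem.1 h3
  let K : Ideal (MvPolynomial (Fin r) ℂ) :=
    Submodule.comap (LinearMap.lsmul (MvPolynomial (Fin r) ℂ) (MvPolynomial (Fin r) ℂ) m.1) J
  have memK : ∀ k, k ∈ K ↔ m.1 * k ∈ J := fun k => Iff.rfl
  have Kcomp : ∀ k ∈ K, ∀ n, homogeneousComponent n k ∈ K := by
    intro k hk n
    rw [memK, ← comp_mul hmhom]
    exact homogeneousComponent_mem_of_mem hJ hk _
  obtain ⟨T, hT⟩ := (isNoetherianRing_iff_ideal_fg _).1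
    (inferInstance : IsNoetherianRing (MvPolynomial (Fin r) ℂ)) K
  let D := T.sup totalDegree
  refine ⟨m.1, hmhom, D + N, fun n hn p hp hmp => ?_⟩
  have key : ∀ x ∈ Ideal.span (T : Set (MvPolynomial (Fin r) ℂ)), ∀ c,
      homogeneousComponent n (c * x) ∈ J := by
    intro x hx
    induction hx using Submodule.span_induction with
    | mem t ht =>
      intro c
      have htK : t ∈ K := hT ▸ Ideal.subset_span ht
      rw [← sum_homogeneousComponent c, ← sum_homogeneousComponent t, Finset.sum_mul_sum, map_sum]
      refine J.sum_mem fun a _ => ?_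
      rw [map_sum]
      refine J.sum_mem fun e he => ?_
      have h := (homogeneousComponent_isHomogeneous a c).mul (homogeneousComponent_isHomogeneous e t)
      rw [homogeneousComponent_of_mem ((mem_homogeneousSubmodule _ _).2 h)]
      split_ifs with hae
      · have hD : t.totalDegree ≤ D := Finset.le_sup (f := totalDegree) ht
        have he' := Finset.mem_range.1 he
        exact kill _ (Kcomp t htK e) a (by omega) _ (homogeneousComponent_isHomogeneous a c)
      · exact J.zero_mem
    | zero => intro c; simp
    | add x y _ _ hx hy => intro c; rw [mul_add, map_add]; exact J.add_mem (hx c) (hy c)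
    | smul a x _ hx => intro c; rw [smul_eq_mul, ← mul_assoc]; exact hx _
  have := key p (by rw [hT]; exact hmp) 1
  rwa [one_mul, homogeneousComponent_of_mem ((mem_homogeneousSubmodule _ _).2 hp), if_pos rfl] at this

theorem chain_lemma {V : Type*} [AddCommGroup V] [Module ℂ V] (C : ℕ → Submodule ℂ V) (n : ℕ)
    (hfin : ∀ i, FiniteDimensional ℂ (C i))
    (hmono : ∀ i, i + 1 ≤ n → C i ≤ C (i + 1)) (h0 : C 0 ≠ ⊥)
    (hstab : ∀ i, i + 2 ≤ n → C i = C (i + 1) → C (i + 1) = C (i + 2)) :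
    ∀ i ≤ n, i + 1 ≤ Module.finrank ℂ (C i) ∨ C i = C n := by
  have hconst : ∀ i, i + 1 ≤ n → C i = C (i + 1) → ∀ k, i + 1 + k ≤ n →
      C (i + k) = C (i + 1 + k) ∧ C i = C (i + 1 + k) := by
    intro i hi h k
    induction k with
    | zero => intro _; exact ⟨h, h⟩
    | succ k ih =>
      intro hk
      obtain ⟨h1, h2⟩ := ih (by omega)
      have h3 : C (i + k + 1) = C (i + k + 2) := hstab (i + k) (by omega)
        (by rw [h1]; congr 1; omega)
      have e1 : i + (k + 1) = i + k + 1 := by omega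
      have e2 : i + 1 + (k + 1) = i + k + 2 := by omega
      rw [e1, e2]
      refine ⟨h3, ?_⟩
      rw [← h3, h2]; congr 1; omega
  have hmono2 : ∀ i, ∀ k, i + k ≤ n → C i ≤ C (i + k) := by
    intro i k
    induction k with
    | zero => intro _; exact le_rfl
    | succ k ih => intro hk; exact (ih (by omega)).trans (hmono _ (by omega))
  intro i
  induction i with
  | zero =>
    intro _
    left
    have := hfin 0
    have := Submodule.one_le_finrank_iff.2 h0
    omega
  | succ i ih =>
    intro hi
    have := hfin (i + 1)
    obtain ⟨k, rfl⟩ := Nat.exists_eq_add_of_le hi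
    rcases ih (by omega) with h | h
    · by_cases heq : C i = C (i + 1)
      · right
        rw [← heq]
        exact (hconst i hi heq k le_rfl).2
      · left
        have := Submodule.finrank_lt_finrank_of_lt (lt_of_le_of_ne (hmono i hi) heq)
        omega
    · right
      refine le_antisymm (hmono2 _ _ le_rfl) ?_
      rw [← h]
      exact hmono i hi

instance fd_hom (r i : ℕ) : FiniteDimensional ℂ (homogeneousSubmodule (Fin r) ℂ i) := by
  have : homogeneousSubmodule (Fin r) ℂ i ≤ restrictTotalDegree (Fin r) ℂ i := by
    intro p hp
    rw [mem_restrictTotalDegree]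
    exact ((mem_homogeneousSubmodule _ _).1 hp).totalDegree_le
  exact Submodule.finiteDimensional_of_le this

theorem hom_succ_le {r : ℕ} (i : ℕ) (W : Submodule ℂ (MvPolynomial (Fin r) ℂ))
    (hW : ∀ (j : Fin r) (q : MvPolynomial (Fin r) ℂ), q.IsHomogeneous i → X j * q ∈ W) :
    homogeneousSubmodule (Fin r) ℂ (i + 1) ≤ W := by
  intro p hp
  have hp' : p.IsHomogeneous (i + 1) := hp
  rw [p.as_sum]
  refine W.sum_mem fun d hd => ?_
  have hdeg := hp' (mem_support_iff.1 hd)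
  have hdeg : Finsupp.degree d = i + 1 := by rw [Finsupp.degree_eq_weight_one]; exact hdeg
  have hne : d ≠ 0 := by rintro rfl; simp at hdeg
  obtain ⟨j, hj⟩ := Finsupp.ne_iff.1 hne
  have hj1 : Finsupp.single j 1 ≤ d := by
    rw [Finsupp.single_le_iff]; simp at hj; omega
  have hd2 : Finsupp.single j 1 + (d - Finsupp.single j 1) = d := add_tsub_cancel_of_le hj1
  have : monomial d (coeff d p) = X j * monomial (d - Finsupp.single j 1) (coeff d p) := by
    rw [X, monomial_mul, hd2, one_mul]
  rw [this]
  apply hW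
  apply isHomogeneous_monomial
  have := congrArg Finsupp.degree hd2
  rw [map_add, Finsupp.degree_single] at this
  omega

theorem hilb_ge {r : ℕ} (J : Ideal (MvPolynomial (Fin r) ℂ))
    (hJ : J.IsHomogeneous (MvPolynomial.homogeneousSubmodule (Fin r) ℂ)) (s : ℕ) (hs : 1 ≤ s)
    (N : ℕ) (hN : ∀ n ≥ N, hilb J n = s) (i : ℕ) : min s (i + 1) ≤ hilb J i := by
  obtain ⟨m, hm, N', hinj⟩ := exists_m J hJ
  let n := N + N' + i
  let φ := (Ideal.Quotient.mkₐ ℂ J).toLinearMap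
  have hφ : ∀ p, φ p = Ideal.Quotient.mk J p := fun p => rfl
  let C : ℕ → Submodule ℂ (MvPolynomial (Fin r) ℂ ⧸ J) := fun k =>
    ((homogeneousSubmodule (Fin r) ℂ k).map φ).map (LinearMap.mulLeft ℂ (φ (m ^ (n - k))))
  have memC : ∀ k q, q ∈ C k ↔ ∃ p : MvPolynomial (Fin r) ℂ, p.IsHomogeneous k ∧
      Ideal.Quotient.mk J (m ^ (n - k) * p) = q := by
    intro k q
    constructor
    · rintro ⟨_, ⟨p, hp, rfl⟩, rfl⟩
      exact ⟨p, hp, by rw [map_mul]; rfl⟩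
    · rintro ⟨p, hp, rfl⟩
      exact ⟨_, ⟨p, hp, rfl⟩, by rw [map_mul]; rfl⟩
  have hfin : ∀ k, FiniteDimensional ℂ (C k) := fun k => inferInstance
  have hle : ∀ k, Module.finrank ℂ (C k) ≤ hilb J k := fun k => Submodule.finrank_map_le _ _
  have hCn : Module.finrank ℂ (C n) = s := by
    rw [← hN n (by omega)]
    have : C n = (homogeneousSubmodule (Fin r) ℂ n).map φ := by
      ext q
      rw [memC]
      simp only [Nat.sub_self, pow_zero, one_mul]
      rfl
    rw [this]; rfl
  have hmono : ∀ k, k + 1 ≤ n → C k ≤ C (k + 1) := by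
    intro k hk q hq
    rw [memC] at hq ⊢
    obtain ⟨p, hp, rfl⟩ := hq
    refine ⟨m * p, by rw [add_comm]; exact hm.mul hp, ?_⟩
    rw [← mul_assoc, ← pow_succ]
    congr 3; omega
  have h0 : C 0 ≠ ⊥ := by
    intro h
    have h1 : Ideal.Quotient.mk J (m ^ n) ∈ C 0 := by
      rw [memC]; exact ⟨1, isHomogeneous_one _ _, by simp⟩
    rw [h, Submodule.mem_bot, Ideal.Quotient.eq_zero_iff_mem] at h1
    have h2 : ∀ k, ∀ a ≥ N', ∀ p : MvPolynomial (Fin r) ℂ, p.IsHomogeneous a →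
        m ^ k * p ∈ J → p ∈ J := by
      intro k
      induction k with
      | zero => intro a _ p _ h; simpa using h
      | succ k ih =>
        intro a ha p hp h
        apply hinj a ha p hp
        refine ih (1 + a) (by omega) _ (hm.mul hp) ?_
        rwa [← mul_assoc, ← pow_succ]
    have h3 : (homogeneousSubmodule (Fin r) ℂ n).map φ = ⊥ := by
      rw [eq_bot_iff]
      rintro _ ⟨p, hp, rfl⟩
      rw [Submodule.mem_bot]
      exact Ideal.Quotient.eq_zero_iff_mem.2 (h2 n n (by omega) p hp (J.mul_mem_right _ h1))
    have h4 := hN n (by omega)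
    have h5 : hilb J n = 0 := by
      change Module.finrank ℂ ((homogeneousSubmodule (Fin r) ℂ n).map φ) = 0
      rw [h3]; simp
    omega
  have hstab : ∀ k, k + 2 ≤ n → C k = C (k + 1) → C (k + 1) = C (k + 2) := by
    intro k hk heq
    refine le_antisymm (hmono _ hk) ?_
    have hh := hom_succ_le (r := r) (k + 1)
      ((C (k + 1)).comap (φ ∘ₗ LinearMap.mulLeft ℂ (m ^ (n - (k + 2))))) ?_
    · intro q hq
      rw [memC] at hq
      obtain ⟨p, hp, rfl⟩ := hq
      exact hh hp
    · intro j q hq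
      change Ideal.Quotient.mk J (m ^ (n - (k + 2)) * (X j * q)) ∈ C (k + 1)
      have h1 : Ideal.Quotient.mk J (m ^ (n - (k + 1)) * q) ∈ C k := by
        rw [heq, memC]; exact ⟨q, hq, rfl⟩
      rw [memC] at h1
      obtain ⟨q', hq', h2⟩ := h1
      rw [memC]
      have hxq' : (X j * q').IsHomogeneous (k + 1) := by
        rw [add_comm]; exact (isHomogeneous_X ℂ j).mul hq'
      have hxq : (X j * q).IsHomogeneous (k + 2) := by
        have := (isHomogeneous_X ℂ j).mul hq
        rwa [show 1 + (k + 1) = k + 2 by omega] at this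
      refine ⟨X j * q', hxq', ?_⟩
      rw [Ideal.Quotient.eq] at h2 ⊢
      have hpow : ∀ a, (m ^ a).IsHomogeneous a := fun a => by simpa using hm.pow a
      refine hinj n (by omega) _ ?_ ?_
      · refine IsHomogeneous.sub ?_ ?_
        · have := (hpow (n - (k + 1))).mul hxq'
          rwa [show n - (k + 1) + (k + 1) = n by omega] at this
        · have := (hpow (n - (k + 2))).mul hxq
          rwa [show n - (k + 2) + (k + 2) = n by omega] at this
      · have e1 : n - k = n - (k + 2) + 2 := by omega
        have e2 : n - (k + 1) = n - (k + 2) + 1 := by omega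
        have h3 := J.mul_mem_left (X j) h2
        rw [e1, e2] at h3
        rw [e2]
        convert h3 using 1
        ring
  rcases chain_lemma C n hfin hmono h0 hstab i (by omega) with h | h
  · have := hle i; omega
  · have := hle i
    rw [h, hCn] at this
    omega

theorem hilb_add {r : ℕ} (P : Ideal (MvPolynomial (Fin r) ℂ))
    (hP : P.IsHomogeneous (MvPolynomial.homogeneousSubmodule (Fin r) ℂ)) (hprime : P.IsPrime)
    (l : MvPolynomial (Fin r) ℂ) (hl : l.IsHomogeneous 1) (hlP : l ∉ P) (i : ℕ) :
    hilb (P ⊔ Ideal.span {l}) (i + 1) + hilb P i = hilb P (i + 1) := by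
  classical
  let J := P ⊔ Ideal.span {l}
  have hPJ : P ≤ J := le_sup_left
  let W := (homogeneousSubmodule (Fin r) ℂ (i + 1)).map (Ideal.Quotient.mkₐ ℂ P).toLinearMap
  let U := (homogeneousSubmodule (Fin r) ℂ i).map (Ideal.Quotient.mkₐ ℂ P).toLinearMap
  let ψ := (Ideal.Quotient.factorₐ ℂ hPJ).toLinearMap
  have h1 : W.map ψ = (homogeneousSubmodule (Fin r) ℂ (i + 1)).map
      (Ideal.Quotient.mkₐ ℂ J).toLinearMap := by
    rw [← Submodule.map_comp]; rfl
  let μ := LinearMap.mulLeft ℂ (Ideal.Quotient.mk P l)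
  have hμ : Function.Injective μ := by
    intro a b hab
    have : Ideal.Quotient.mk P l ≠ 0 := fun h => hlP (Ideal.Quotient.eq_zero_iff_mem.1 h)
    exact mul_left_cancel₀ this hab
  have h2 : U.map μ = (LinearMap.ker (ψ.domRestrict W)).map W.subtype := by
    ext q
    constructor
    · rintro ⟨_, ⟨p, hp, rfl⟩, rfl⟩
      refine ⟨⟨Ideal.Quotient.mk P (l * p), ⟨l * p, ?_, rfl⟩⟩, ?_, ?_⟩
      · have := hl.mul hp
        rw [add_comm] at this
        exact this
      · change Ideal.Quotient.mk J (l * p) = 0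
        refine Ideal.Quotient.eq_zero_iff_mem.2 (J.mul_mem_right _ ?_)
        exact (le_sup_right : Ideal.span {l} ≤ J) (Ideal.mem_span_singleton_self l)
      · change Ideal.Quotient.mk P (l * p) = _
        rw [map_mul]; rfl
    · rintro ⟨⟨_, ⟨p, hp, rfl⟩⟩, hk, rfl⟩
      have hk' : p ∈ J := Ideal.Quotient.eq_zero_iff_mem.1 hk
      obtain ⟨a, ha, b, hb, hab⟩ := Submodule.mem_sup.1 hk'
      obtain ⟨c, rfl⟩ := Ideal.mem_span_singleton.1 hb
      refine ⟨_, ⟨homogeneousComponent i c, homogeneousComponent_mem _ _, rfl⟩, ?_⟩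
      change Ideal.Quotient.mk P l * Ideal.Quotient.mk P (homogeneousComponent i c) =
        Ideal.Quotient.mk P p
      rw [← map_mul, eq_comm, Ideal.Quotient.eq]
      have h3 := congrArg (homogeneousComponent (i + 1)) hab
      rw [homogeneousComponent_of_mem hp, if_pos rfl, map_add, comp_mul hl] at h3
      rw [← h3, add_sub_cancel_right]
      exact homogeneousComponent_mem_of_mem hP ha _
  have h3 := LinearMap.finrank_range_add_finrank_ker (ψ.domRestrict W)
  have h4 : LinearMap.range (ψ.domRestrict W) = W.map ψ := LinearMap.range_domRestrict _ _
  have h5 : Module.finrank ℂ (U.map μ) = Module.finrank ℂ U :=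
    (Submodule.equivMapOfInjective μ hμ U).finrank_eq.symm
  have h6 : Module.finrank ℂ ((LinearMap.ker (ψ.domRestrict W)).map W.subtype) =
      Module.finrank ℂ (LinearMap.ker (ψ.domRestrict W)) :=
    (Submodule.equivMapOfInjective _ W.injective_subtype _).finrank_eq.symm
  rw [h4, h1, ← h6, ← h2, h5] at h3
  exact h3

/-- Remark (Halphen, (v)): let `Σ ⊂ ℙ^{r−1}` (projective space on `r` variables) be a
non-degenerate integral curve of degree `s` and arithmetic genus `π`, with `r − 1 ≥ 3`
and `s ≥ r − 1`.  Integrality is expressed by the homogeneous ideal `P` being prime,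
non-degeneracy by `P` containing no nonzero linear form, and the degree and genus via
the Hilbert polynomial `hilb P i = s·i + 1 − π` for `i ≫ 0`.  Then `π < (s−1 choose 2)`,
and consequently `(d/(2s))(2π − 2 − s) < (d/2)(s − 4)` for every `d > 0` (with `s ≥ 2`). -/
theorem stmt_5 (r : ℕ) (hr : 4 ≤ r) (P : Ideal (MvPolynomial (Fin r) ℂ))
    (hPhom : P.IsHomogeneous (MvPolynomial.homogeneousSubmodule (Fin r) ℂ))
    (hPprime : P.IsPrime)
    (hnondeg : ∀ ℓ ∈ MvPolynomial.homogeneousSubmodule (Fin r) ℂ 1, ℓ ∈ P → ℓ = 0)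
    (s : ℕ) (hs : r - 1 ≤ s) (π : ℤ)
    (hHilbPoly : ∃ N : ℕ, ∀ i ≥ N, (hilb P i : ℤ) = s * i + (1 - π)) :
    π < ((s - 1).choose 2 : ℤ) ∧
      ∀ d : ℚ, 0 < d →
        d / (2 * s) * (2 * (π : ℚ) - 2 - s) < d / 2 * ((s : ℚ) - 4) := by
  obtain ⟨N, hN⟩ := hHilbPoly
  let l : MvPolynomial (Fin r) ℂ := X ⟨0, by omega⟩
  have hl : l.IsHomogeneous 1 := isHomogeneous_X ℂ _
  have hlP : l ∉ P := fun h => X_ne_zero _ (hnondeg l hl h)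
  have hadd := hilb_add P hPhom hPprime l hl hlP
  have hJ : (P ⊔ Ideal.span {l}).IsHomogeneous (homogeneousSubmodule (Fin r) ℂ) := by
    refine hPhom.sup (Ideal.homogeneous_span _ _ ?_)
    rintro x rfl
    exact ⟨1, hl⟩
  have hJs : ∀ n ≥ N + 1, hilb (P ⊔ Ideal.span {l}) n = s := by
    intro n hn
    obtain ⟨k, rfl⟩ : ∃ k, n = k + 1 := ⟨n - 1, by omega⟩
    have h1 := hN k (by omega)
    have h2 := hN (k + 1) (by omega)
    have h3 := hadd k
    zify at h3 ⊢
    push_cast at h2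
    linarith
  have hge := hilb_ge _ hJ s (by omega) (N + 1) hJs
  have h1 : 4 ≤ hilb P 1 := by
    have : hilb P 1 = r := by
      unfold hilb
      have hi : Function.Injective ((Ideal.Quotient.mkₐ ℂ P).toLinearMap.domRestrict
          (homogeneousSubmodule (Fin r) ℂ 1)) := by
        rw [injective_iff_map_eq_zero]
        rintro ⟨a, ha⟩ h
        have : a ∈ P := Ideal.Quotient.eq_zero_iff_mem.1 h
        exact Subtype.ext (hnondeg a ha this)
      have e := LinearMap.finrank_range_of_inj hi
      rw [LinearMap.range_domRestrict] at e
      rw [e, homogeneousSubmodule_one_eq_span_X]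
      rw [finrank_span_eq_card]
      · simp
      · exact linearIndependent_X _ _
    omega
  have hlow : ∀ i, i + 2 ≤ s → (i + 2) * (i + 3) + 2 ≤ 2 * hilb P (i + 1) := by
    intro i
    induction i with
    | zero => intro _; rw [zero_add, zero_add, zero_add]; omega
    | succ i ih =>
      intro hi
      have a := ih (by omega)
      have b := hge (i + 1 + 1)
      have c := hadd (i + 1)
      rw [min_eq_right (by omega)] at b
      nlinarith
  have hlow2 : ∀ t, s * (s + 1) + 2 + 2 * s * t ≤ 2 * hilb P (s - 1 + t) := by
    intro t
    induction t with
    | zero =>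
      have := hlow (s - 2) (by omega)
      rw [show s - 2 + 2 = s by omega, show s - 2 + 3 = s + 1 by omega,
        show s - 2 + 1 = s - 1 by omega] at this
      simpa using this
    | succ t ih =>
      have b := hge (s - 1 + t + 1)
      have c := hadd (s - 1 + t)
      rw [min_eq_left (by omega)] at b
      rw [← add_assoc]
      nlinarith
  have hmain : 2 * π ≤ (s : ℤ) * s - 3 * s := by
    have a := hlow2 N
    have b := hN (s - 1 + N) (by omega)
    zify at a
    rw [b] at a
    rw [Nat.cast_add, Nat.cast_sub (by omega : 1 ≤ s)] at a
    push_cast at a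
    nlinarith
  have hch : 2 * ((s - 1).choose 2 : ℤ) = ((s : ℤ) - 1) * (s - 2) := by
    obtain ⟨k, rfl⟩ : ∃ k, s = k + 2 := ⟨s - 2, by omega⟩
    have := Nat.choose_two_right (k + 1)
    have h2 := Nat.triangle_succ k
    have h3 : 2 * (k + 1).choose 2 = (k + 1) * k := by
      rw [this]
      exact Nat.mul_div_cancel' (by simpa [mul_comm] using (Nat.even_mul_succ_self k).two_dvd)
    rw [show k + 2 - 1 = k + 1 by omega]
    zify at h3
    rw [h3]; push_cast; ring
  refine ⟨by nlinarith, fun d hd => ?_⟩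
  have hs0 : (0 : ℚ) < s := by exact_mod_cast (by omega : 0 < s)
  have hq : 2 * (π : ℚ) ≤ (s : ℚ) * s - 3 * s := by exact_mod_cast hmain
  have e : d / 2 * ((s : ℚ) - 4) = d / (2 * s) * (s * (s - 4)) := by field_simp
  rw [e]
  apply mul_lt_mul_of_pos_left _ (by positivity)
  nlinarith
end

section
/- Let S be an integral projective surface in ℙ^r of degree s ≥ 1 and sectional genus π. Then every projective scheme C ⊂ S of dimension 1 and degree d > 0 satisfies p_a(C) ≤ d²/(2s) + (d/(2s))(2π − 2 − s) + s⁴. -/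
open MvPolynomial

attribute [local instance] MvPolynomial.gradedAlgebra

namespace CurveBound

section Basic

variable {k : Type*} [Field k] {n : ℕ}

/-- Homogeneity of an ideal through homogeneous components. -/
def HomI (I : Ideal (MvPolynomial (Fin n) k)) : Prop :=
  ∀ f ∈ I, ∀ i, homogeneousComponent i f ∈ I

/-- `f` is a nonzerodivisor modulo `I`. -/
def Reg (I : Ideal (MvPolynomial (Fin n) k)) (f : MvPolynomial (Fin n) k) : Prop :=
  ∀ g, f * g ∈ I → g ∈ I

/-- `I` is saturated with respect to the irrelevant ideal. -/
def IsSat (I : Ideal (MvPolynomial (Fin n) k)) : Prop :=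
  ∀ f, (∀ j, X j * f ∈ I) → f ∈ I

/-- Degree `i` piece of `I`. -/
noncomputable def gr (I : Ideal (MvPolynomial (Fin n) k)) (i : ℕ) : Submodule k (MvPolynomial (Fin n) k) :=
  I.restrictScalars k ⊓ homogeneousSubmodule (Fin n) k i

lemma mem_gr {I : Ideal (MvPolynomial (Fin n) k)} {i : ℕ} {f : MvPolynomial (Fin n) k} :
    f ∈ gr I i ↔ f ∈ I ∧ f.IsHomogeneous i := by
  simp [gr, mem_homogeneousSubmodule]

/-- Hilbert function, as an integer. -/
noncomputable def hf (I : Ideal (MvPolynomial (Fin n) k)) (i : ℕ) : ℤ :=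
  (Module.finrank k (homogeneousSubmodule (Fin n) k i) : ℤ) - Module.finrank k (gr I i)

instance finHom (i : ℕ) : FiniteDimensional k (homogeneousSubmodule (Fin n) k i) :=
  Module.Finite.iff_fg.mpr (homogeneousSubmodule_fg (Fin n) k i)

lemma gr_le (I : Ideal (MvPolynomial (Fin n) k)) (i : ℕ) :
    gr I i ≤ homogeneousSubmodule (Fin n) k i := inf_le_right

instance finGr (I : Ideal (MvPolynomial (Fin n) k)) (i : ℕ) : FiniteDimensional k (gr I i) :=
  Submodule.finiteDimensional_of_le (gr_le I i)

lemma gr_mono {I I' : Ideal (MvPolynomial (Fin n) k)} (h : I ≤ I') (i : ℕ) : gr I i ≤ gr I' i :=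
  fun f hf => by rw [mem_gr] at *; exact ⟨h hf.1, hf.2⟩

lemma hf_anti {I I' : Ideal (MvPolynomial (Fin n) k)} (h : I ≤ I') (i : ℕ) : hf I' i ≤ hf I i := by
  have := Submodule.finrank_mono (gr_mono h i)
  unfold hf; omega

lemma hf_nonneg (I : Ideal (MvPolynomial (Fin n) k)) (i : ℕ) : 0 ≤ hf I i := by
  have := Submodule.finrank_mono (gr_le I i)
  unfold hf; omega

lemma gr_eq_of_hf {I I' : Ideal (MvPolynomial (Fin n) k)} (h : I ≤ I') {i : ℕ}
    (he : hf I i = hf I' i) : gr I i = gr I' i := by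
  apply Submodule.eq_of_le_of_finrank_eq (gr_mono h i)
  unfold hf at he; omega

lemma hf_congr {I I' : Ideal (MvPolynomial (Fin n) k)} {i : ℕ}
    (he : gr I i = gr I' i) : hf I i = hf I' i := by
  unfold hf; rw [he]

lemma hf_eq_zero {I : Ideal (MvPolynomial (Fin n) k)} {i : ℕ} :
    hf I i = 0 ↔ ∀ f : MvPolynomial (Fin n) k, f.IsHomogeneous i → f ∈ I := by
  constructor
  · intro h f hf'
    have : gr I i = homogeneousSubmodule (Fin n) k i := by
      apply Submodule.eq_of_le_of_finrank_eq (gr_le I i)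
      unfold hf at h; omega
    have h2 : f ∈ gr I i := by rw [this]; exact hf'
    exact (mem_gr.1 h2).1
  · intro h
    have : gr I i = homogeneousSubmodule (Fin n) k i := by
      apply le_antisymm (gr_le I i)
      intro f hf'
      exact mem_gr.2 ⟨h f hf', hf'⟩
    unfold hf; rw [this]; omega

lemma decompose_eq (f : MvPolynomial (Fin n) k) (i : ℕ) :
    ((DirectSum.decompose (homogeneousSubmodule (Fin n) k) f i : MvPolynomial (Fin n) k)) =
      homogeneousComponent i f := by
  exact decomposition.decompose'_apply f i

lemma comp_mul {f : MvPolynomial (Fin n) k} {m : ℕ} (hf : f.IsHomogeneous m)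
    (g : MvPolynomial (Fin n) k) (i : ℕ) :
    homogeneousComponent (i + m) (f * g) = f * homogeneousComponent i g := by
  have := DirectSum.coe_decompose_mul_of_left_mem_of_le
    (𝒜 := homogeneousSubmodule (Fin n) k) (a := f) (b := g) (i := m) (n := i + m) hf (by omega)
  rw [decompose_eq, decompose_eq] at this
  simpa using this

lemma comp_mul_lt {f : MvPolynomial (Fin n) k} {m : ℕ} (hf : f.IsHomogeneous m)
    (g : MvPolynomial (Fin n) k) {i : ℕ} (hi : i < m) :
    homogeneousComponent i (f * g) = 0 := by
  have := DirectSum.coe_decompose_mul_of_left_mem_of_not_le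
    (𝒜 := homogeneousSubmodule (Fin n) k) (a := f) (b := g) (i := m) (n := i) hf (by omega)
  rw [decompose_eq] at this
  simpa using this

lemma comp_self {f : MvPolynomial (Fin n) k} {i : ℕ} (hf : f.IsHomogeneous i) :
    homogeneousComponent i f = f := homogeneousComponent_eq_self hf

lemma homI_of {I : Ideal (MvPolynomial (Fin n) k)}
    (h : I.IsHomogeneous (homogeneousSubmodule (Fin n) k)) : HomI I := by
  intro f hf i
  have := h i hf
  rwa [decompose_eq] at this

lemma HomI.sup {I I' : Ideal (MvPolynomial (Fin n) k)} (h : HomI I) (h' : HomI I') :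
    HomI (I ⊔ I') := by
  intro f hf i
  obtain ⟨a, ha, b, hb, rfl⟩ := Submodule.mem_sup.1 hf
  rw [map_add]
  exact Submodule.add_mem_sup (h a ha i) (h' b hb i)

lemma homI_span {f : MvPolynomial (Fin n) k} {m : ℕ} (hf : f.IsHomogeneous m) :
    HomI (Ideal.span {f}) := by
  intro g hg i
  obtain ⟨a, rfl⟩ := Ideal.mem_span_singleton.1 hg
  by_cases him : i < m
  · rw [comp_mul_lt hf a him]; exact zero_mem _
  · obtain ⟨j, rfl⟩ := Nat.exists_eq_add_of_le (not_lt.1 him)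
    rw [add_comm, comp_mul hf]
    exact Ideal.mem_span_singleton.2 ⟨_, rfl⟩

lemma HomI.addSpan {I : Ideal (MvPolynomial (Fin n) k)} (h : HomI I)
    {f : MvPolynomial (Fin n) k} {m : ℕ} (hf : f.IsHomogeneous m) :
    HomI (I ⊔ Ideal.span {f}) := h.sup (homI_span hf)

/-- multiplication by `f` as a linear map. -/
noncomputable abbrev mulL (f : MvPolynomial (Fin n) k) :
    MvPolynomial (Fin n) k →ₗ[k] MvPolynomial (Fin n) k := LinearMap.mulLeft k f

lemma hf_sup {I : Ideal (MvPolynomial (Fin n) k)} (hI : HomI I)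
    {f : MvPolynomial (Fin n) k} {m : ℕ} (hfm : f.IsHomogeneous m) (hreg : Reg I f) (hf0 : f ≠ 0)
    (i : ℕ) : hf (I ⊔ Ideal.span {f}) (i + m) = hf I (i + m) - hf I i := by
  have hinj : Function.Injective (mulL f) := by
    intro a b hab
    simpa [hf0] using hab
  set A := gr I (i + m) with hA
  set B := (homogeneousSubmodule (Fin n) k i).map (mulL f) with hB
  have h1 : gr (I ⊔ Ideal.span {f}) (i + m) = A ⊔ B := by
    apply le_antisymm
    · intro g hg
      obtain ⟨hg, hgh⟩ := mem_gr.1 hg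
      obtain ⟨a, ha, b, hb, rfl⟩ := Submodule.mem_sup.1 hg
      obtain ⟨b, rfl⟩ := Ideal.mem_span_singleton.1 hb
      rw [← comp_self hgh, map_add, comp_mul hfm]
      apply Submodule.add_mem_sup
      · exact mem_gr.2 ⟨hI a ha _, homogeneousComponent_isHomogeneous _ _⟩
      · exact ⟨homogeneousComponent i b, homogeneousComponent_mem i b, rfl⟩
    · apply sup_le (gr_mono le_sup_left _)
      rintro _ ⟨b, hb, rfl⟩
      apply mem_gr.2
      refine ⟨Ideal.mem_sup_right (Ideal.mem_span_singleton.2 ⟨_, rfl⟩), ?_⟩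
      rw [add_comm]
      exact hfm.mul hb
  have h2 : A ⊓ B = (gr I i).map (mulL f) := by
    apply le_antisymm
    · rintro _ ⟨ha, ⟨b, hb, rfl⟩⟩
      refine ⟨b, mem_gr.2 ⟨hreg _ (mem_gr.1 ha).1, hb⟩, rfl⟩
    · rintro _ ⟨b, hb, rfl⟩
      obtain ⟨hb, hbh⟩ := mem_gr.1 hb
      refine ⟨mem_gr.2 ⟨I.mul_mem_left _ hb, ?_⟩, ⟨b, hbh, rfl⟩⟩
      rw [add_comm]
      exact hfm.mul hbh
  have h3 := Submodule.finrank_sup_add_finrank_inf_eq A B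
  rw [h2, ← h1] at h3
  have h4 : Module.finrank k B = Module.finrank k (homogeneousSubmodule (Fin n) k i) :=
    (Submodule.equivMapOfInjective _ hinj _).finrank_eq.symm
  have h5 : Module.finrank k ((gr I i).map (mulL f)) = Module.finrank k (gr I i) :=
    (Submodule.equivMapOfInjective _ hinj _).finrank_eq.symm
  rw [h4, h5, hA] at h3
  unfold hf
  omega

lemma hf_sup_lt {I : Ideal (MvPolynomial (Fin n) k)} (hI : HomI I)
    {f : MvPolynomial (Fin n) k} {m : ℕ} (hfm : f.IsHomogeneous m)
    {i : ℕ} (hi : i < m) : hf (I ⊔ Ideal.span {f}) i = hf I i := by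
  apply hf_congr
  apply le_antisymm _ (gr_mono le_sup_left _)
  intro g hg
  obtain ⟨hg, hgh⟩ := mem_gr.1 hg
  obtain ⟨a, ha, b, hb, rfl⟩ := Submodule.mem_sup.1 hg
  obtain ⟨b, rfl⟩ := Ideal.mem_span_singleton.1 hb
  refine mem_gr.2 ⟨?_, hgh⟩
  rw [← comp_self hgh, map_add, comp_mul_lt hfm _ hi, add_zero]
  exact hI a ha _

/-- Sum formula for a regular linear form. -/
lemma hf_sum {I : Ideal (MvPolynomial (Fin n) k)} (hI : HomI I)
    {f : MvPolynomial (Fin n) k} (hfm : f.IsHomogeneous 1) (hreg : Reg I f) (hf0 : f ≠ 0)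
    (i : ℕ) : hf I i = ∑ j ∈ Finset.range (i + 1), hf (I ⊔ Ideal.span {f}) j := by
  induction i with
  | zero => simp [hf_sup_lt hI hfm]
  | succ i ih =>
    rw [Finset.sum_range_succ, ← ih, hf_sup hI hfm hreg hf0]
    ring

/-- Saturation. -/
def sat (I : Ideal (MvPolynomial (Fin n) k)) : Ideal (MvPolynomial (Fin n) k) where
  carrier := {f | ∃ N, ∀ j, X j ^ N * f ∈ I}
  zero_mem' := ⟨0, fun j => by simp⟩
  add_mem' := by
    rintro a b ⟨N, hN⟩ ⟨M, hM⟩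
    refine ⟨N + M, fun j => ?_⟩
    have e : X j ^ (N + M) * (a + b) = X j ^ M * (X j ^ N * a) + X j ^ N * (X j ^ M * b) := by
      ring
    rw [e]
    exact I.add_mem (I.mul_mem_left _ (hN j)) (I.mul_mem_left _ (hM j))
  smul_mem' := by
    rintro c a ⟨N, hN⟩
    refine ⟨N, fun j => ?_⟩
    have e : X j ^ N * (c • a) = c * (X j ^ N * a) := by
      simp only [smul_eq_mul]; ring
    rw [e]
    exact I.mul_mem_left _ (hN j)

lemma mem_sat {I : Ideal (MvPolynomial (Fin n) k)} {f : MvPolynomial (Fin n) k} :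
    f ∈ sat I ↔ ∃ N, ∀ j, X j ^ N * f ∈ I := Iff.rfl

lemma le_sat (I : Ideal (MvPolynomial (Fin n) k)) : I ≤ sat I :=
  fun f hf => ⟨0, fun j => by simpa using hf⟩

lemma sat_mono {I I' : Ideal (MvPolynomial (Fin n) k)} (h : I ≤ I') : sat I ≤ sat I' :=
  fun _ ⟨N, hN⟩ => ⟨N, fun j => h (hN j)⟩

lemma isSat_sat (I : Ideal (MvPolynomial (Fin n) k)) : IsSat (sat I) := by
  intro f hf
  choose N hN using fun j => mem_sat.1 (hf j)
  refine ⟨(∑ j, N j) + 1, fun j => ?_⟩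
  have h1 : N j ≤ ∑ j, N j := Finset.single_le_sum (f := N) (fun _ _ => Nat.zero_le _)
    (Finset.mem_univ j)
  obtain ⟨c, hc⟩ := Nat.exists_eq_add_of_le h1
  have e : X j ^ ((∑ j, N j) + 1) * f = X j ^ c * (X j ^ N j * (X j * f)) := by
    rw [hc]; ring
  rw [e]
  exact I.mul_mem_left _ (hN j j)

lemma HomI.sat {I : Ideal (MvPolynomial (Fin n) k)} (h : HomI I) : HomI (sat I) := by
  rintro f ⟨N, hN⟩ i
  refine ⟨N, fun j => ?_⟩
  have hX : (X j ^ N : MvPolynomial (Fin n) k).IsHomogeneous N := isHomogeneous_X_pow j N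
  rw [← comp_mul hX]
  exact h _ (hN j) _

lemma pigeon {I : Ideal (MvPolynomial (Fin n) k)} {f : MvPolynomial (Fin n) k} {N : ℕ}
    (hN : ∀ j, X j ^ N * f ∈ I) {c : MvPolynomial (Fin n) k} {m : ℕ} (hc : c.IsHomogeneous m)
    (hm : n * N < m) : c * f ∈ I := by
  rw [c.as_sum, Finset.sum_mul]
  apply I.sum_mem
  intro d hd
  have hdeg : d.degree = m := by
    by_contra hne
    exact (mem_support_iff.1 hd) (hc.coeff_eq_zero hne)
  obtain ⟨j, hj⟩ : ∃ j, N ≤ d j := by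
    by_contra hcon
    push Not at hcon
    have : d.degree ≤ ∑ j : Fin n, N := by
      rw [Finsupp.degree_eq_sum]
      exact Finset.sum_le_sum fun j _ => (hcon j).le
    simp at this
    omega
  have e : d = Finsupp.single j N + (d - Finsupp.single j N) := by
    rw [add_tsub_cancel_of_le]
    simpa using hj
  have e2 : monomial d (coeff d c) = X j ^ N * monomial (d - Finsupp.single j N) (coeff d c) := by
    rw [X_pow_eq_monomial, monomial_mul, one_mul, ← e]
  rw [e2, mul_assoc, mul_left_comm]
  exact I.mul_mem_left _ (hN j)

lemma sat_eventually {I : Ideal (MvPolynomial (Fin n) k)} (h : HomI I) :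
    ∃ N, ∀ i ≥ N, hf (sat I) i = hf I i := by
  obtain ⟨G, hG⟩ := (isNoetherianRing_iff_ideal_fg _).1
    (inferInstance : IsNoetherianRing (MvPolynomial (Fin n) k)) (sat I)
  have hGs : ∀ g ∈ G, ∃ N, ∀ j, X j ^ N * g ∈ I := by
    intro g hg
    apply mem_sat.1
    rw [← hG]
    exact Ideal.subset_span hg
  -- each generator: large components of multiples lie in I
  have key : ∀ g, (∃ N, ∀ j, X j ^ N * g ∈ I) → ∃ D, ∀ c : MvPolynomial (Fin n) k, ∀ i ≥ D,
      homogeneousComponent i (c * g) ∈ I := by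
    rintro g ⟨N, hN⟩
    refine ⟨g.totalDegree + n * N + 1, fun c i hi => ?_⟩
    rw [← sum_homogeneousComponent g, Finset.mul_sum, map_sum]
    apply I.sum_mem
    intro e he
    have he' : e ≤ g.totalDegree := by simpa [Nat.lt_succ_iff] using he
    have hge : (homogeneousComponent e g).IsHomogeneous e := homogeneousComponent_isHomogeneous _ _
    obtain ⟨i', rfl⟩ := Nat.exists_eq_add_of_le (show e ≤ i by omega)
    rw [mul_comm, add_comm e, comp_mul hge, mul_comm]
    apply pigeon (N := N) _ (homogeneousComponent_isHomogeneous i' c) (by omega)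
    intro j
    have hX : (X j ^ N : MvPolynomial (Fin n) k).IsHomogeneous N := isHomogeneous_X_pow j N
    rw [← comp_mul hX]
    exact h _ (hN j) _
  choose! D hD using fun g hg => key g (hGs g hg)
  refine ⟨∑ g ∈ G, D g, fun i hi => ?_⟩
  apply hf_congr
  apply le_antisymm _ (gr_mono (le_sat I) i)
  intro f hf
  obtain ⟨hfs, hfh⟩ := mem_gr.1 hf
  refine mem_gr.2 ⟨?_, hfh⟩
  rw [← hG] at hfs
  have : ∀ f ∈ Ideal.span (G : Set (MvPolynomial (Fin n) k)), homogeneousComponent i f ∈ I := by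
    intro f hf
    induction hf using Submodule.span_induction with
    | mem g hg =>
      have := hD g hg 1 i (le_trans (Finset.single_le_sum (f := D) (fun _ _ => Nat.zero_le _) hg) hi)
      simpa using this
    | zero => simp
    | add x y _ _ hx hy => rw [map_add]; exact I.add_mem hx hy
    | smul a x hx hxx =>
      -- strengthen by writing x as a combination
      clear hxx
      induction hx using Submodule.span_induction generalizing a with
      | mem g hg =>
        exact hD g hg a i (le_trans (Finset.single_le_sum (f := D) (fun _ _ => Nat.zero_le _) hg) hi)
      | zero => simp
      | add x y _ _ hx hy => rw [smul_add, map_add]; exact I.add_mem (hx a) (hy a)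
      | smul b x _ hx => rw [smul_smul]; exact hx (a * b)
  rw [← comp_self hfh]
  exact this f hfs

/-- A common nonzerodivisor linear form for two saturated ideals. -/
lemma exists_reg [Infinite k] {I I' : Ideal (MvPolynomial (Fin n) k)} (h : IsSat I)
    (h' : IsSat I') : ∃ f : MvPolynomial (Fin n) k, f.IsHomogeneous 1 ∧ Reg I f ∧ Reg I' f := by
  have hfin : ∀ I : Ideal (MvPolynomial (Fin n) k), (associatedPrimes (MvPolynomial (Fin n) k) (MvPolynomial (Fin n) k ⧸ I)).Finite := fun I =>
    associatedPrimes.finite _ (MvPolynomial (Fin n) k ⧸ I)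
  have hprime : ∀ I : Ideal (MvPolynomial (Fin n) k), IsSat I → ∀ p ∈ associatedPrimes (MvPolynomial (Fin n) k) (MvPolynomial (Fin n) k ⧸ I), ∃ j, X j ∉ p := by
    intro I hI p hp
    by_contra hcon
    push Not at hcon
    obtain ⟨hpp, x, hx⟩ := (isAssociatedPrime_iff).1 hp
    obtain ⟨g, rfl⟩ := Ideal.Quotient.mk_surjective x
    have hmem : ∀ a : MvPolynomial (Fin n) k, a ∈ p ↔ a * g ∈ I := by
      intro a
      rw [hx, Submodule.mem_colon_singleton, Submodule.mem_bot]
      change Ideal.Quotient.mk I (a * g) = 0 ↔ _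
      rw [Ideal.Quotient.eq_zero_iff_mem]
    have hg : g ∈ I := hI g fun j => (hmem _).1 (hcon j)
    exact hpp.ne_top ((Ideal.eq_top_iff_one _).2 ((hmem 1).2 (by simpa using hg)))
  have hreg : ∀ I : Ideal (MvPolynomial (Fin n) k), ∀ f : MvPolynomial (Fin n) k, (∀ p ∈ associatedPrimes (MvPolynomial (Fin n) k) (MvPolynomial (Fin n) k ⧸ I), f ∉ p) → Reg I f := by
    intro I f hf g hg
    by_contra hgI
    have h1 : f ∈ ⋃ p ∈ associatedPrimes (MvPolynomial (Fin n) k) (MvPolynomial (Fin n) k ⧸ I), (p : Set (MvPolynomial (Fin n) k)) := by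
      rw [biUnion_associatedPrimes_eq_zero_divisors]
      refine ⟨Ideal.Quotient.mk I g, ?_, ?_⟩
      · rwa [Ne, Ideal.Quotient.eq_zero_iff_mem]
      · change Ideal.Quotient.mk I (f * g) = 0
        rwa [Ideal.Quotient.eq_zero_iff_mem]
    simp only [Set.mem_iUnion] at h1
    obtain ⟨p, hp, hfp⟩ := h1
    exact hf p hp hfp
  let T : Set (Ideal (MvPolynomial (Fin n) k)) := associatedPrimes (MvPolynomial (Fin n) k) (MvPolynomial (Fin n) k ⧸ I) ∪ associatedPrimes (MvPolynomial (Fin n) k) (MvPolynomial (Fin n) k ⧸ I')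
  have hT : T.Finite := (hfin I).union (hfin I')
  let L := homogeneousSubmodule (Fin n) k 1
  let V : Ideal (MvPolynomial (Fin n) k) → Submodule k L := fun p => (p.restrictScalars k).comap L.subtype
  have hV : ∀ p ∈ T, V p ≠ ⊤ := by
    intro p hp htop
    obtain ⟨j, hj⟩ : ∃ j, X j ∉ p := by
      rcases hp with hp | hp
      · exact hprime I h p hp
      · exact hprime I' h' p hp
    have : (⟨X j, isHomogeneous_X k j⟩ : L) ∈ V p := by rw [htop]; trivial
    exact hj this
  have h2 := Subspace.biUnion_ne_univ_of_top_notMem (k := k) (E := L)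
    (s := (hT.image V).toFinset) (by
      intro hc
      simp only [Set.Finite.mem_toFinset, Set.mem_image] at hc
      obtain ⟨p, hp, hpt⟩ := hc
      exact hV p hp hpt)
  obtain ⟨f, hf⟩ := (Set.ne_univ_iff_exists_notMem _).1 h2
  simp only [Set.mem_iUnion, not_exists, Set.Finite.mem_toFinset] at hf
  have hf' : ∀ p ∈ T, (f : MvPolynomial (Fin n) k) ∉ p := fun p hp hfp => hf (V p) ⟨p, hp, rfl⟩ hfp
  exact ⟨f, f.2, hreg I f fun p hp => hf' p (Or.inl hp), hreg I' f fun p hp => hf' p (Or.inr hp)⟩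

end Basic

section ZeroDim

variable {k : Type*} [Field k] {n : ℕ}

lemma hf_zero_one {I : Ideal (MvPolynomial (Fin n) k)} (h : (1 : MvPolynomial (Fin n) k) ∉ I) :
    hf I 0 = 1 := by
  have h1 : gr I 0 = ⊥ := by
    rw [eq_bot_iff]
    intro f hf
    obtain ⟨hfI, hfh⟩ := mem_gr.1 hf
    rw [← comp_self hfh, homogeneousComponent_zero] at hfI ⊢
    by_cases hc : coeff 0 f = 0
    · simp [hc]
    · exfalso
      apply h
      have := I.mul_mem_left (C (coeff 0 f)⁻¹) hfI
      rwa [← map_mul, inv_mul_cancel₀ hc, map_one] at this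
  have h2 : Module.finrank k (homogeneousSubmodule (Fin n) k 0) = 1 := by
    rw [homogeneousSubmodule_zero, Submodule.one_eq_span]
    exact finrank_span_singleton one_ne_zero
  unfold hf
  rw [h1, h2]
  simp

/-- a linear regular form is nonzero when the ideal is proper -/
lemma reg_ne_zero {I : Ideal (MvPolynomial (Fin n) k)} (h : (1 : MvPolynomial (Fin n) k) ∉ I)
    {f : MvPolynomial (Fin n) k} (hr : Reg I f) : f ≠ 0 := by
  rintro rfl
  exact h (hr 1 (by simp))

lemma one_not_mem_of_hf {I : Ideal (MvPolynomial (Fin n) k)} {i : ℕ} (h : hf I i ≠ 0) :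
    (1 : MvPolynomial (Fin n) k) ∉ I := by
  intro h1
  apply h
  rw [hf_eq_zero]
  intro f _
  rw [(Ideal.eq_top_iff_one I).2 h1]
  trivial

lemma hom_of_succ {I : Ideal (MvPolynomial (Fin n) k)} {i : ℕ}
    (h : ∀ f : MvPolynomial (Fin n) k, f.IsHomogeneous i → f ∈ I) :
    ∀ f : MvPolynomial (Fin n) k, f.IsHomogeneous (i + 1) → f ∈ I := by
  intro f hf
  have h1 : f ∈ homogeneousSubmodule (Fin n) k i * homogeneousSubmodule (Fin n) k 1 := by
    rw [← homogeneousSubmodule_one_pow, ← pow_succ, homogeneousSubmodule_one_pow]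
    exact hf
  refine Submodule.mul_induction_on h1 ?_ ?_
  · intro a ha b _
    exact I.mul_mem_right _ (h a ha)
  · intro a b ha hb
    exact I.add_mem ha hb

lemma hf_zero_later {I : Ideal (MvPolynomial (Fin n) k)} {i : ℕ} (h : hf I i = 0) (j : ℕ) :
    hf I (i + j) = 0 := by
  induction j with
  | zero => exact h
  | succ j ih => exact hf_eq_zero.2 (hom_of_succ (hf_eq_zero.1 ih))

section
variable [Infinite k] {Γ : Ideal (MvPolynomial (Fin n) k)} {d : ℤ}

lemma zd_mono (hΓ : HomI Γ) (hs : IsSat Γ) (i : ℕ) : hf Γ i ≤ hf Γ (i + 1) := by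
  by_cases h1 : (1 : MvPolynomial (Fin n) k) ∈ Γ
  · have : ∀ i, hf Γ i = 0 := fun i => by
      by_contra hc
      exact one_not_mem_of_hf hc h1
    rw [this, this]
  obtain ⟨f, hf1, hfr, -⟩ := exists_reg hs hs
  have := hf_sup hΓ hf1 hfr (reg_ne_zero h1 hfr) i
  have := hf_nonneg (Γ ⊔ Ideal.span {f}) (i + 1)
  omega

lemma zd_mono' (hΓ : HomI Γ) (hs : IsSat Γ) {i j : ℕ} (hij : i ≤ j) : hf Γ i ≤ hf Γ j :=
  monotone_nat_of_le_succ (zd_mono hΓ hs) hij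

lemma zd_le (hΓ : HomI Γ) (hs : IsSat Γ) (hd : ∃ N, ∀ i ≥ N, hf Γ i = d) (i : ℕ) :
    hf Γ i ≤ d := by
  obtain ⟨N, hN⟩ := hd
  rw [← hN (max N i) (le_max_left _ _)]
  exact zd_mono' hΓ hs (le_max_right _ _)

lemma zd_strict (hΓ : HomI Γ) (hs : IsSat Γ) (hd : ∃ N, ∀ i ≥ N, hf Γ i = d) {i : ℕ}
    (hi : hf Γ i < d) : hf Γ i + 1 ≤ hf Γ (i + 1) := by
  obtain ⟨N, hN⟩ := hd
  have h1 : (1 : MvPolynomial (Fin n) k) ∉ Γ := by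
    apply one_not_mem_of_hf (i := N)
    have := hf_nonneg Γ i
    rw [hN N le_rfl]; omega
  obtain ⟨f, hf1, hfr, -⟩ := exists_reg hs hs
  have hsup := hf_sup hΓ hf1 hfr (reg_ne_zero h1 hfr)
  by_contra hcon
  have h0 : hf (Γ ⊔ Ideal.span {f}) (i + 1) = 0 := by
    have := hf_nonneg (Γ ⊔ Ideal.span {f}) (i + 1)
    have := hsup i
    omega
  have : ∀ j, hf Γ (i + j) = hf Γ i := by
    intro j
    induction j with
    | zero => rfl
    | succ j ih =>
      have e1 := hf_zero_later h0 j
      have e2 := hsup (i + j)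
      rw [show i + 1 + j = i + j + 1 by ring] at e1
      rw [← add_assoc]
      omega
  have e := hN (i + N) (by omega)
  rw [this N] at e
  omega

lemma zd_lower (hΓ : HomI Γ) (hs : IsSat Γ) (hd : ∃ N, ∀ i ≥ N, hf Γ i = d) (hd0 : 0 < d)
    (i : ℕ) : min d (i + 1) ≤ hf Γ i := by
  have h1 : (1 : MvPolynomial (Fin n) k) ∉ Γ := by
    obtain ⟨N, hN⟩ := hd
    apply one_not_mem_of_hf (i := N)
    rw [hN N le_rfl]; omega
  induction i with
  | zero => rw [hf_zero_one h1]; simp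
  | succ i ih =>
    have := zd_mono hΓ hs i
    rcases lt_or_ge (hf Γ i) d with h | h
    · have := zd_strict hΓ hs hd h
      push_cast
      omega
    · push_cast
      omega

/-- The tail sum of the defects `d - hf Γ`. -/
lemma zd_tail (hΓ : HomI Γ) (hs : IsSat Γ) (hd : ∃ N, ∀ i ≥ N, hf Γ i = d) (m : ℕ) (i : ℕ) :
    2 * ∑ j ∈ Finset.range m, (d - hf Γ (i + 1 + j)) ≤ (d - hf Γ i) * (d - hf Γ i - 1) := by
  induction m generalizing i with
  | zero =>
    have := zd_le hΓ hs hd i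
    rcases this.lt_or_eq with h | h
    · simp only [Finset.range_zero, Finset.sum_empty, mul_zero]
      apply mul_nonneg <;> omega
    · simp [h]
  | succ m ih =>
    rw [Finset.sum_range_succ']
    have e : ∀ j, i + 1 + (j + 1) = (i + 1) + 1 + j := fun j => by ring
    have e' : ∑ j ∈ Finset.range m, (d - hf Γ (i + 1 + (j + 1))) =
        ∑ j ∈ Finset.range m, (d - hf Γ ((i + 1) + 1 + j)) :=
      Finset.sum_congr rfl fun j _ => by rw [e j]
    rw [e']
    have h := ih (i + 1)
    have h1 := zd_le hΓ hs hd i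
    have h2 := zd_le hΓ hs hd (i + 1)
    rcases h1.lt_or_eq with h3 | h3
    · have h4 := zd_strict hΓ hs hd h3
      simp only [add_zero]
      nlinarith
    · have h4 := zd_mono hΓ hs i
      have h5 : hf Γ (i + 1) = d := by omega
      rw [h5, sub_self, zero_mul] at h
      rw [add_zero, h5, h3, sub_self, zero_mul]
      linarith

/-- A zero-dimensional saturated ideal of degree `s` is generated in degrees `≤ s`. -/
lemma zd_gen (hΓ : HomI Γ) (hs : IsSat Γ) {s : ℕ} (hs0 : 0 < s)
    (hd : ∃ N, ∀ i ≥ N, hf Γ i = s) {I : Ideal (MvPolynomial (Fin n) k)}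
    (hI : I ≤ Γ) {i : ℕ} (hi : s ≤ i) (he : hf I i = s) : hf I (i + 1) = s := by
  have h1 : (1 : MvPolynomial (Fin n) k) ∉ Γ := by
    obtain ⟨N, hN⟩ := hd
    apply one_not_mem_of_hf (i := N)
    rw [hN N le_rfl]; omega
  have hval : ∀ j, s ≤ j + 1 → hf Γ j = s := by
    intro j hj
    have a1 := zd_lower hΓ hs hd (by omega) j
    have a2 := zd_le hΓ hs hd j
    omega
  obtain ⟨f, hf1, hfr, -⟩ := exists_reg hs hs
  have hsup := hf_sup hΓ hf1 hfr (reg_ne_zero h1 hfr)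
  obtain ⟨i, rfl⟩ : ∃ i', i = i' + 1 := ⟨i - 1, by omega⟩
  have h0 : hf (Γ ⊔ Ideal.span {f}) (i + 1) = 0 := by
    rw [hsup, hval i hi, hval (i + 1) (by omega)]; ring
  have hW := hf_eq_zero.1 h0
  have hgr : gr I (i + 1) = gr Γ (i + 1) := gr_eq_of_hf hI (by rw [he, hval _ (by omega)])
  rw [← hval (i + 1 + 1) (by omega)]
  apply hf_congr
  apply le_antisymm (gr_mono hI _)
  intro g hg
  obtain ⟨hgΓ, hgh⟩ := mem_gr.1 hg
  refine mem_gr.2 ⟨?_, hgh⟩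
  -- every form of degree i+2 is in I + f * R_{i+1}
  have key : ∀ g : MvPolynomial (Fin n) k, g.IsHomogeneous (i + 1 + 1) →
      ∃ a ∈ I, ∃ b : MvPolynomial (Fin n) k, b.IsHomogeneous (i + 1) ∧ g = a + f * b := by
    intro g hg
    have h1 : g ∈ homogeneousSubmodule (Fin n) k (i + 1) * homogeneousSubmodule (Fin n) k 1 := by
      rw [← homogeneousSubmodule_one_pow, ← pow_succ, homogeneousSubmodule_one_pow]
      exact hg
    refine Submodule.mul_induction_on h1 ?_ ?_
    · intro a ha b hb
      have ha' : a.IsHomogeneous (i + 1) := ha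
      obtain ⟨z, hz, w, hw, hzw⟩ := Submodule.mem_sup.1 (hW a ha)
      obtain ⟨w, rfl⟩ := Ideal.mem_span_singleton.1 hw
      have ea : a = homogeneousComponent (i + 1) z + f * homogeneousComponent i w := by
        rw [← comp_mul hf1, ← map_add, hzw, comp_self ha']
      have hzI : homogeneousComponent (i + 1) z ∈ I := by
        have : homogeneousComponent (i + 1) z ∈ gr Γ (i + 1) :=
          mem_gr.2 ⟨hΓ z hz _, homogeneousComponent_isHomogeneous _ _⟩
        rw [← hgr] at this
        exact (mem_gr.1 this).1
      refine ⟨b * homogeneousComponent (i + 1) z, I.mul_mem_left _ hzI,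
        homogeneousComponent i w * b, (homogeneousComponent_isHomogeneous i w).mul hb, ?_⟩
      rw [ea]
      ring
    · rintro x y ⟨a, ha, b, hb, rfl⟩ ⟨a', ha', b', hb', rfl⟩
      exact ⟨a + a', I.add_mem ha ha', b + b', hb.add hb', by ring⟩
  obtain ⟨a, ha, b, hb, rfl⟩ := key g hgh
  have hbΓ : b ∈ Γ := by
    apply hfr
    have := Γ.sub_mem hgΓ (hI ha)
    simpa using this
  have hbI : b ∈ gr I (i + 1) := by rw [hgr]; exact mem_gr.2 ⟨hbΓ, hb⟩
  exact I.add_mem ha (I.mul_mem_left _ (mem_gr.1 hbI).1)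

end

end ZeroDim

section CurveSec

variable {k : Type*} [Field k] {n : ℕ}
  {Q Γ : Ideal (MvPolynomial (Fin n) k)} {s : ℕ} {c d : ℤ}

lemma prime_reg (hQ : Q.IsPrime) {f : MvPolynomial (Fin n) k} (hf : f ∉ Q) : Reg Q f :=
  fun _ hg => (hQ.mem_or_mem hg).resolve_left hf

lemma bezout (hQ : Q.IsPrime) (hQh : HomI Q)
    (hQs : ∃ N : ℕ, ∀ i ≥ N, hf Q i = s * i + c) (hQΓ : Q ≤ Γ)
    (hd : ∃ N : ℕ, ∀ i ≥ N, hf Γ i = d) {i : ℕ} (hi : (s * i : ℤ) < d) : hf Γ i = hf Q i := by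
  symm
  apply hf_congr
  apply le_antisymm (gr_mono hQΓ i)
  intro f hf
  obtain ⟨hfΓ, hfh⟩ := mem_gr.1 hf
  by_contra hcon
  have hfQ : f ∉ Q := fun h => hcon (mem_gr.2 ⟨h, hfh⟩)
  have hf0 : f ≠ 0 := by rintro rfl; exact hfQ Q.zero_mem
  obtain ⟨N, hN⟩ := hQs
  obtain ⟨M, hM⟩ := hd
  have h1 := hf_sup hQh hfh (prime_reg hQ hfQ) hf0 (N + M)
  have h2 : Q ⊔ Ideal.span {f} ≤ Γ := sup_le hQΓ ((Ideal.span_singleton_le_iff_mem _).2 hfΓ)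
  have h3 := hf_anti h2 (N + M + i)
  rw [h1, hM _ (by omega), hN _ (by omega), hN _ (by omega)] at h3
  push_cast at h3
  linarith

lemma c_le [Infinite k] (hQ : Q.IsPrime) (hQh : HomI Q) (hQsat : IsSat Q)
    (hQs : ∃ N : ℕ, ∀ i ≥ N, hf Q i = s * i + c) (hs : 1 ≤ s) : c ≤ s := by
  obtain ⟨y, hy1, hyr, -⟩ := exists_reg hQsat hQsat
  have h1Q : (1 : MvPolynomial (Fin n) k) ∉ Q := fun h => hQ.ne_top ((Ideal.eq_top_iff_one _).2 h)
  have hyQ : y ∉ Q := fun h => h1Q (hyr 1 (by simpa using h))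
  obtain ⟨N, hN⟩ := id hQs
  have hya : (y ^ (N + 1)).IsHomogeneous (N + 1) := by
    have := hy1.pow (N + 1)
    rwa [one_mul] at this
  have hyaQ : y ^ (N + 1) ∉ Q := fun h => hyQ (hQ.mem_of_pow_mem _ h)
  have hI := hQh.addSpan hya
  set I := Q ⊔ Ideal.span {y ^ (N + 1)} with hIdef
  have hd : ∃ M : ℕ, ∀ i ≥ M, hf (sat I) i = s * (N + 1) := by
    obtain ⟨M, hM⟩ := sat_eventually hI
    refine ⟨M + N + N + 1, fun i hi => ?_⟩
    rw [hM i (by omega)]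
    obtain ⟨j, rfl⟩ : ∃ j, i = j + (N + 1) := ⟨i - (N + 1), by omega⟩
    rw [hIdef, hf_sup hQh hya (prime_reg hQ hyaQ) (by rintro h; exact hyaQ (h ▸ Q.zero_mem)),
      hN _ (by omega), hN _ (by omega)]
    push_cast
    ring
  have h1 := bezout (i := N) hQ hQh hQs (le_sup_left.trans (le_sat I)) hd (by
    have : (0 : ℤ) < s := by omega
    nlinarith)
  have h2 := zd_le hI.sat (isSat_sat I) hd N
  rw [h1, hN N le_rfl] at h2
  linarith

/-- Structure of the Hilbert function of an integral curve: the deficits. -/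
lemma deficit [Infinite k] (hQ : Q.IsPrime) (hQh : HomI Q) (hQsat : IsSat Q)
    (hQs : ∃ N : ℕ, ∀ i ≥ N, hf Q i = s * i + c) (hs : 1 ≤ s) :
    (∀ i : ℕ, i + 1 ≤ s → ((i : ℤ) + 1) * (i + 2) ≤ 2 * hf Q i) ∧
    (∀ i : ℕ, s ≤ i + 1 → 0 ≤ s * i + c - hf Q i) ∧
    (∀ i : ℕ, s ≤ i + 1 → 0 < s * i + c - hf Q i →
      s * (i + 1) + c - hf Q (i + 1) + 1 ≤ s * i + c - hf Q i) ∧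
    (∀ i : ℕ, s ≤ i + 1 → s * (i + 1) + c - hf Q (i + 1) ≤ s * i + c - hf Q i) := by
  obtain ⟨y, hy1, hyr, -⟩ := exists_reg hQsat hQsat
  have h1Q : (1 : MvPolynomial (Fin n) k) ∉ Q := fun h => hQ.ne_top ((Ideal.eq_top_iff_one _).2 h)
  have hy0 := reg_ne_zero h1Q hyr
  obtain ⟨N, hN⟩ := id hQs
  have hI := hQh.addSpan hy1
  have hsup := hf_sup hQh hy1 hyr hy0
  set I := Q ⊔ Ideal.span {y} with hIdef
  have hd : ∃ M : ℕ, ∀ i ≥ M, hf (sat I) i = (s : ℤ) := by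
    obtain ⟨M, hM⟩ := sat_eventually hI
    refine ⟨M + N + 1, fun i hi => ?_⟩
    rw [hM i (by omega)]
    obtain ⟨j, rfl⟩ : ∃ j, i = j + 1 := ⟨i - 1, by omega⟩
    rw [hsup, hN _ (by omega), hN _ (by omega)]
    push_cast
    ring
  have hlow := zd_lower hI.sat (isSat_sat I) hd (by omega)
  have hanti := hf_anti (le_sat I)
  have hmono : ∀ i : ℕ, s ≤ i + 1 →
      s * (i + 1) + c - hf Q (i + 1) ≤ s * i + c - hf Q i := by
    intro i hi
    have e1 := hlow (i + 1)
    have e2 := hanti (i + 1)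
    have e3 := hsup i
    have e4 : (s : ℤ) ≤ hf I (i + 1) := by push_cast at e1; omega
    linarith
  have hmono' : ∀ i : ℕ, s ≤ i + 1 → ∀ j : ℕ,
      s * ((i + j : ℕ) : ℤ) + c - hf Q (i + j) ≤ s * i + c - hf Q i := by
    intro i hi j
    induction j with
    | zero => simp
    | succ j ih =>
      have := hmono (i + j) (by omega)
      rw [← add_assoc]
      push_cast at this ih ⊢
      linarith
  refine ⟨?_, ?_, ?_, hmono⟩
  · intro i hi
    induction i with
    | zero => rw [hf_zero_one h1Q]; norm_num
    | succ i ih =>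
      have e1 := hlow (i + 1)
      have e2 := hanti (i + 1)
      have e3 := hsup i
      have e4 := ih (by omega)
      have e5 : (i : ℤ) + 2 ≤ hf I (i + 1) := by push_cast at e1; omega
      push_cast
      nlinarith
  · intro i hi
    have := hmono' i hi N
    rw [hN _ (by omega)] at this
    linarith
  · intro i hi hpos
    by_contra hcon
    have e3 := hsup i
    have e4 := hmono i hi
    have e5 : hf I (i + 1) = s := by linarith
    have e6 : ∀ j, hf I (i + 1 + j) = s := by
      intro j
      induction j with
      | zero => exact e5
      | succ j ih => exact zd_gen (i := i + 1 + j) hI.sat (isSat_sat I) hs hd (le_sat I) (by omega) ih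
    have e7 : ∀ j : ℕ, s * ((i + j : ℕ) : ℤ) + c - hf Q (i + j) = s * i + c - hf Q i := by
      intro j
      induction j with
      | zero => simp
      | succ j ih =>
        have a1 := e6 j
        have a2 := hsup (i + j)
        rw [show i + 1 + j = i + j + 1 by ring] at a1
        rw [← add_assoc]
        push_cast at ih ⊢
        linarith
    have e8 := e7 N
    rw [hN _ (by omega)] at e8
    linarith

end CurveSec

section Numeric

lemma numeric {s b e c SD TL N : ℤ} (hs : 1 ≤ s) (he0 : 0 ≤ e) (hes : e + 1 ≤ s)
    (hc : 3 * s - s ^ 2 ≤ 2 * c) (hN : 2 * N = s * (s - 1))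
    (hSD : 2 * SD ≤ 2 * (s - 1) * N + N * (N + 1)) (hTL : 2 * TL ≤ N ^ 2) :
    2 * s * ((s * (b + 1) - e) * b + 1 + SD + TL) - s * (s * (b + 1) * b) - 2 * s * c * (b + 1)
      ≤ (s * (b + 1) - e) ^ 2 - (s * (b + 1) - e) * (2 * c + s) + 2 * s ^ 5 := by
  have h1 : 2 * s * ((s * (b + 1) - e) * b + 1 + SD + TL) - s * (s * (b + 1) * b)
      - 2 * s * c * (b + 1) - ((s * (b + 1) - e) ^ 2 - (s * (b + 1) - e) * (2 * c + s))
      = s * e - e ^ 2 - 2 * e * c + 2 * s + 2 * s * (SD + TL) := by ring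
  have h2 : - (e * (2 * c)) ≤ e * (s ^ 2 - 3 * s) := by nlinarith
  have h3 : 2 * s * (SD + TL) ≤ s * (2 * (s - 1) * N + N * (N + 1) + N ^ 2) := by nlinarith
  suffices h : s * e + e * (s ^ 2 - 3 * s) + 2 * s
      + s * (2 * (s - 1) * N + N * (N + 1) + N ^ 2) ≤ 2 * s ^ 5 by nlinarith [sq_nonneg e]
  have h4 : s * e + e * (s ^ 2 - 3 * s) + 2 * s + s * (2 * (s - 1) * N + N * (N + 1) + N ^ 2)
      = s * (e * (s - 2) + 2 + 2 * (s - 1) * N + N * (N + 1) + N ^ 2) := by ring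
  rw [h4, show 2 * s ^ 5 = s * (2 * s ^ 4) by ring]
  apply mul_le_mul_of_nonneg_left _ (by omega)
  rcases hs.lt_or_eq with hs2 | hs1
  · have hs2 : 2 ≤ s := hs2
    obtain ⟨t, rfl⟩ : ∃ t, s = t + 2 := ⟨s - 2, by ring⟩
    have ht : 0 ≤ t := by omega
    have h5 : e * (t + 2 - 2) ≤ (t + 1) * t := by nlinarith
    have h6 : 4 * N ^ 2 = ((t + 2) * (t + 2 - 1)) ^ 2 := by rw [← hN]; ring
    have h7 : 2 * (2 * (t + 2 - 1) * N) = 2 * (t + 2 - 1) * ((t + 2) * (t + 2 - 1)) := by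
      rw [← hN]; ring
    have h8 : 0 ≤ t ^ 2 := by positivity
    have h9 : 0 ≤ t ^ 3 := by positivity
    have h10 : 0 ≤ t ^ 4 := by positivity
    nlinarith
  · subst hs1
    have : e = 0 := by omega
    have hN0 : N = 0 := by omega
    subst this; subst hN0
    norm_num

variable {k : Type*} [Field k] [Infinite k] {n : ℕ}
  {Q Γ : Ideal (MvPolynomial (Fin n) k)} {s d : ℕ} {c : ℤ}

lemma deficit_tail {D : ℕ → ℤ} {s : ℕ} (h0 : ∀ i, s ≤ i + 1 → 0 ≤ D i)
    (h1 : ∀ i, s ≤ i + 1 → 0 < D i → D (i + 1) + 1 ≤ D i)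
    (h2 : ∀ i, s ≤ i + 1 → D (i + 1) ≤ D i) (m i : ℕ) (hi : s ≤ i + 1) :
    2 * ∑ j ∈ Finset.range m, D (i + j) ≤ D i * (D i + 1) := by
  induction m generalizing i with
  | zero =>
    have := h0 i hi
    simp only [Finset.range_zero, Finset.sum_empty, mul_zero]
    positivity
  | succ m ih =>
    rw [Finset.sum_range_succ', add_zero]
    have e' : ∑ j ∈ Finset.range m, D (i + (j + 1)) = ∑ j ∈ Finset.range m, D ((i + 1) + j) :=
      Finset.sum_congr rfl fun j _ => by rw [show i + (j + 1) = (i + 1) + j by ring]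
    rw [e']
    have h := ih (i + 1) (by omega)
    have a0 := h0 i hi
    have a1 := h0 (i + 1) (by omega)
    rcases a0.lt_or_eq with h3 | h3
    · have := h1 i hi h3
      nlinarith
    · have := h2 i hi
      have h5 : D (i + 1) = 0 := by omega
      rw [h5] at h
      rw [← h3]
      linarith

lemma main_curve (hQ : Q.IsPrime) (hQh : HomI Q) (hQsat : IsSat Q)
    (hQs : ∃ N : ℕ, ∀ i ≥ N, hf Q i = s * i + c) (hs : 1 ≤ s)
    (hQΓ : Q ≤ Γ) (hΓ : HomI Γ) (hΓsat : IsSat Γ)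
    (hd : ∃ N : ℕ, ∀ i ≥ N, hf Γ i = (d : ℤ)) (hd0 : 0 < d) :
    ∃ M : ℕ, ∀ i ≥ M, 2 * (s : ℤ) * (d * i + 1 - ∑ j ∈ Finset.range (i + 1), hf Γ j) ≤
      (d : ℤ) ^ 2 - d * (2 * c + s) + 2 * s ^ 5 := by
  obtain ⟨b, hb1, hb2⟩ : ∃ b : ℕ, s * b < d ∧ d ≤ s * (b + 1) := by
    refine ⟨(d - 1) / s, ?_, ?_⟩
    · have := Nat.mul_div_le (d - 1) s
      omega
    · have := Nat.lt_mul_div_succ (d - 1) (show 0 < s by omega)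
      omega
  obtain ⟨e, he⟩ := Nat.exists_eq_add_of_le hb2
  have hdz : (d : ℤ) = s * (b + 1) - e := by
    have : ((s * (b + 1) : ℕ) : ℤ) = d + e := by exact_mod_cast he
    push_cast at this
    linarith
  have hes : (e : ℤ) + 1 ≤ s := by
    have : ((s * b : ℕ) : ℤ) < d := by exact_mod_cast hb1
    push_cast at this
    nlinarith
  obtain ⟨hl, hn, hst, hmo⟩ := deficit hQ hQh hQsat hQs hs
  have hcs := c_le hQ hQh hQsat hQs hs
  set D : ℕ → ℤ := fun i => s * i + c - hf Q i with hD
  have hn' : ∀ i, s ≤ i + 1 → 0 ≤ D i := hn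
  have hst' : ∀ i, s ≤ i + 1 → 0 < D i → D (i + 1) + 1 ≤ D i := by
    intro i hi h; have := hst i hi h; simp only [hD]; push_cast; linarith
  have hmo' : ∀ i, s ≤ i + 1 → D (i + 1) ≤ D i := by
    intro i hi; have := hmo i hi; simp only [hD]; push_cast; linarith
  obtain ⟨N, hN⟩ : ∃ N : ℤ, 2 * N = s * (s - 1) := by
    have h := Int.even_mul_pred_self (s : ℤ)
    obtain ⟨N, hN⟩ := h
    exact ⟨N, by linarith⟩
  have hN0 : 0 ≤ N := by
    have : (1 : ℤ) ≤ s := by exact_mod_cast hs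
    nlinarith
  have hDlow : ∀ i : ℕ, i + 1 ≤ s → 2 * D i ≤ s ^ 2 - 3 * s + 2 * c := by
    intro i hi
    have h1 := hl i hi
    have h2 : (i : ℤ) + 1 ≤ s := by exact_mod_cast hi
    simp only [hD]
    obtain ⟨t, ht⟩ := Nat.exists_eq_add_of_le hi
    have hz : (s : ℤ) = i + 1 + t := by exact_mod_cast ht
    have h3 : (0 : ℤ) ≤ t * (t - 1) := by
      rcases Nat.eq_zero_or_pos t with h | h
      · simp [h]
      · have : (1 : ℤ) ≤ t := by exact_mod_cast h
        nlinarith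
    have h4 : (s : ℤ) ^ 2 - 3 * s - 2 * s * i + (i + 1) * (i + 2) = t * (t - 1) := by
      rw [hz]; ring
    linarith
  have hDall : ∀ i : ℕ, 2 * D i ≤ s ^ 2 - 3 * s + 2 * c := by
    intro i
    rcases le_or_gt (i + 1) s with h | h
    · exact hDlow i h
    · obtain ⟨j, rfl⟩ : ∃ j, i = (s - 1) + j := ⟨i - (s - 1), by omega⟩
      clear h
      induction j with
      | zero => exact hDlow _ (by omega)
      | succ j ih =>
        have := hmo' (s - 1 + j) (by omega)
        rw [← add_assoc]
        linarith
  have hDN : ∀ i, D i ≤ N := fun i => by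
    have := hDall i
    nlinarith
  have hc : 3 * (s : ℤ) - s ^ 2 ≤ 2 * c := by
    have h1 := hDall (s - 1)
    have h2 := hn' (s - 1) (by omega)
    linarith
  -- sum of deficits
  have hSD : 2 * ∑ i ∈ Finset.range (b + 1), D i ≤ 2 * (s - 1) * N + N * (N + 1) := by
    have hsmall : ∀ m : ℕ, m ≤ s - 1 → ∑ i ∈ Finset.range m, D i ≤ (s - 1) * N := by
      intro m hm
      have h1 : ∑ i ∈ Finset.range m, D i ≤ ∑ i ∈ Finset.range m, N :=
        Finset.sum_le_sum fun i _ => hDN i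
      rw [Finset.sum_const, Finset.card_range, nsmul_eq_mul] at h1
      have h2 : (m : ℤ) ≤ s - 1 := by omega
      nlinarith
    rcases le_or_gt (b + 1) (s - 1) with h | h
    · have := hsmall _ h
      nlinarith
    · obtain ⟨m, hm⟩ := Nat.exists_eq_add_of_le h.le
      rw [hm, Finset.sum_range_add]
      have h1 := hsmall (s - 1) le_rfl
      have h2 := deficit_tail hn' hst' hmo' m (s - 1) (by omega)
      have h3 := hn' (s - 1) (by omega)
      have h4 := hDN (s - 1)
      nlinarith
  have hbez : ∀ i ≤ b, hf Γ i = s * i + c - D i := by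
    intro i hi
    rw [bezout (i := i) hQ hQh hQs hQΓ hd]
    · simp [hD]
    · have : s * i ≤ s * b := Nat.mul_le_mul_left _ hi
      exact_mod_cast lt_of_le_of_lt this hb1
  have hτ0 := zd_le hΓ hΓsat hd b
  have hτ : 2 * (d - hf Γ b) ≤ 2 * N := by
    rw [hbez b le_rfl]
    have := hDall b
    rw [hdz]
    nlinarith
  refine ⟨b, fun i hi => ?_⟩
  obtain ⟨m, rfl⟩ := Nat.exists_eq_add_of_le hi
  have hTL : 2 * ∑ j ∈ Finset.range m, (d - hf Γ (b + 1 + j)) ≤ N ^ 2 := by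
    have := zd_tail hΓ hΓsat hd m b
    nlinarith
  have hfirst : 2 * ∑ j ∈ Finset.range (b + 1), hf Γ j =
      s * (b + 1) * b + 2 * c * (b + 1) - 2 * ∑ i ∈ Finset.range (b + 1), D i := by
    have h1 : ∑ j ∈ Finset.range (b + 1), hf Γ j =
        ∑ j ∈ Finset.range (b + 1), ((s : ℤ) * j + c - D j) :=
      Finset.sum_congr rfl fun j hj => hbez j (by simpa [Nat.lt_succ_iff] using hj)
    have h2 : ∀ b : ℕ, 2 * ∑ j ∈ Finset.range (b + 1), ((s : ℤ) * j + c) =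
        s * (b + 1) * b + 2 * c * (b + 1) := by
      intro b
      induction b with
      | zero => simp
      | succ b ih => rw [Finset.sum_range_succ, mul_add, ih]; push_cast; ring
    rw [h1, Finset.sum_sub_distrib, mul_sub, h2]
  have hsecond : ∑ j ∈ Finset.range m, ((d : ℤ) - hf Γ (b + 1 + j)) =
      d * m - ∑ j ∈ Finset.range m, hf Γ (b + 1 + j) := by
    rw [Finset.sum_sub_distrib]
    simp [mul_comm]
  have hnum := numeric (b := b) (c := c) (by exact_mod_cast hs) (Int.natCast_nonneg e) hes hc hN
    hSD hTL
  rw [← hdz] at hnum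
  rw [show b + m + 1 = b + 1 + m by ring, Finset.sum_range_add]
  rw [hsecond] at hnum
  push_cast
  refine le_trans (le_of_eq ?_) hnum
  linear_combination (-(s : ℤ)) * hfirst

end Numeric
section HilbEq

lemma hilb_eq {m : ℕ} (I : Ideal (MvPolynomial (Fin m) ℂ)) (i : ℕ) : (hilb I i : ℤ) = hf I i := by
  set V := homogeneousSubmodule (Fin m) ℂ i with hV
  set q := (Ideal.Quotient.mkₐ ℂ I).toLinearMap with hq
  have h1 := LinearMap.finrank_range_add_finrank_ker (q.domRestrict V)
  have h2 : LinearMap.range (q.domRestrict V) = V.map q := by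
    rw [LinearMap.range_domRestrict]
  have h3 : Module.finrank ℂ (LinearMap.ker (q.domRestrict V)) = Module.finrank ℂ (gr I i) := by
    have : (LinearMap.ker (q.domRestrict V)).map V.subtype = gr I i := by
      ext f
      rw [mem_gr]
      simp only [Submodule.mem_map, LinearMap.mem_ker, LinearMap.domRestrict_apply,
        Submodule.subtype_apply, Subtype.exists, exists_and_right, exists_eq_right, hV,
        mem_homogeneousSubmodule, hq]
      constructor
      · rintro ⟨a, b⟩
        exact ⟨Ideal.Quotient.eq_zero_iff_mem.1 b, a⟩
      · rintro ⟨a, b⟩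
        exact ⟨b, Ideal.Quotient.eq_zero_iff_mem.2 a⟩
    rw [← this]
    exact (LinearEquiv.finrank_eq
      (Submodule.equivMapOfInjective _ V.injective_subtype _))
  rw [h2, h3] at h1
  have h4 : hilb I i = Module.finrank ℂ (V.map q) := rfl
  unfold hf
  rw [h4, ← h1]
  push_cast
  ring

end HilbEq

section BaseChange

variable {k K : Type*} [Field k] [Field K] [Algebra k K] {n : ℕ}

/-- Base change of polynomial rings. -/
noncomputable abbrev bc (k K : Type*) [Field k] [Field K] [Algebra k K] (n : ℕ) :
    MvPolynomial (Fin n) k →+* MvPolynomial (Fin n) K := MvPolynomial.map (algebraMap k K)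

lemma finrank_span (V : Submodule k (MvPolynomial (Fin n) k)) :
    Module.finrank K (Submodule.span K (bc k K n '' V)) = Module.finrank k V := by
  have h1 : Module.finrank K (V.baseChange K) = Module.finrank k V := by
    rw [← (Submodule.toBaseChange.toLinearEquiv K V).finrank_eq, Module.finrank_baseChange]
  let e := (algebraTensorAlgEquiv (σ := Fin n) k K).toLinearEquiv
  have h2 : (V.baseChange K).map e.toLinearMap = Submodule.span K (bc k K n '' V) := by
    rw [Submodule.baseChange_eq_span, Submodule.map_span]
    congr 1
    ext f
    simp only [Set.mem_image, SetLike.mem_coe, Submodule.mem_map]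
    constructor
    · rintro ⟨x, ⟨y, hy, rfl⟩, rfl⟩
      refine ⟨y, hy, ?_⟩
      simp [e, algebraTensorAlgEquiv_tmul]
    · rintro ⟨y, hy, rfl⟩
      refine ⟨_, ⟨y, hy, rfl⟩, ?_⟩
      simp [e, algebraTensorAlgEquiv_tmul]
  rw [← h2, ← h1]
  exact LinearEquiv.finrank_map_eq e _

lemma comp_bc (a : MvPolynomial (Fin n) k) (i : ℕ) :
    homogeneousComponent i (bc k K n a) = bc k K n (homogeneousComponent i a) := by
  ext d
  simp only [coeff_homogeneousComponent, coeff_map]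
  split_ifs <;> simp

lemma hom_span (i : ℕ) : homogeneousSubmodule (Fin n) K i =
    Submodule.span K (bc k K n '' (homogeneousSubmodule (Fin n) k i)) := by
  apply le_antisymm
  · intro f hf
    rw [f.as_sum]
    refine Submodule.sum_mem _ fun d hd => ?_
    have : monomial d (coeff d f) = coeff d f • bc k K n (monomial d 1) := by
      simp [smul_monomial]
    rw [this]
    refine Submodule.smul_mem _ _ (Submodule.subset_span ⟨_, ?_, rfl⟩)
    have hdeg : d.degree = i := by
      by_contra hne
      exact (mem_support_iff.1 hd) (IsHomogeneous.coeff_eq_zero hf hne)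
    exact isHomogeneous_monomial _ hdeg
  · rw [Submodule.span_le]
    rintro _ ⟨a, ha, rfl⟩
    exact IsHomogeneous.map ha _

lemma comp_mem_span {I : Ideal (MvPolynomial (Fin n) k)} (hI : HomI I)
    {f : MvPolynomial (Fin n) K} (hf : f ∈ I.map (bc k K n)) :
    ∀ i, homogeneousComponent i f ∈ Submodule.span K (bc k K n '' (gr I i)) := by
  induction hf using Submodule.span_induction with
  | mem x hx =>
    obtain ⟨a, ha, rfl⟩ := hx
    intro i
    rw [comp_bc]
    exact Submodule.subset_span ⟨_, mem_gr.2 ⟨hI a ha i, homogeneousComponent_isHomogeneous i a⟩, rfl⟩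
  | zero => intro i; simp
  | add x y _ _ hx hy => intro i; rw [map_add]; exact add_mem (hx i) (hy i)
  | smul r x _ hx =>
    intro i
    rw [smul_eq_mul, r.as_sum, Finset.sum_mul, map_sum]
    refine Submodule.sum_mem _ fun d hd => ?_
    have hm : (monomial d (coeff d r)).IsHomogeneous d.degree := isHomogeneous_monomial _ rfl
    by_cases hi : i < d.degree
    · rw [comp_mul_lt hm _ hi]; exact zero_mem _
    · obtain ⟨j, rfl⟩ := Nat.exists_eq_add_of_le (not_lt.1 hi)
      rw [add_comm, comp_mul hm]
      have := hx j
      generalize homogeneousComponent j x = y at this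
      induction this using Submodule.span_induction with
      | mem z hz =>
        obtain ⟨a, ha, rfl⟩ := hz
        have e1 : monomial d (coeff d r) * bc k K n a =
            coeff d r • bc k K n (monomial d 1 * a) := by
          rw [map_mul, ← smul_mul_assoc]
          simp [smul_monomial]
        rw [e1]
        refine Submodule.smul_mem _ _ (Submodule.subset_span ⟨_, mem_gr.2 ⟨?_, ?_⟩, rfl⟩)
        · exact I.mul_mem_left _ (mem_gr.1 ha).1
        · rw [add_comm]
          exact (isHomogeneous_monomial _ rfl).mul (mem_gr.1 ha).2
      | zero => simp
      | add z w _ _ hz hw => rw [mul_add]; exact add_mem hz hw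
      | smul c z _ hz => rw [mul_smul_comm]; exact Submodule.smul_mem _ _ hz

lemma span_gr_le {I : Ideal (MvPolynomial (Fin n) k)} (i : ℕ) :
    Submodule.span K (bc k K n '' (gr I i)) ≤ gr (I.map (bc k K n)) i := by
  rw [Submodule.span_le]
  rintro _ ⟨a, ha, rfl⟩
  exact mem_gr.2 ⟨Ideal.mem_map_of_mem _ (mem_gr.1 ha).1, IsHomogeneous.map (mem_gr.1 ha).2 _⟩

lemma HomI.bc {I : Ideal (MvPolynomial (Fin n) k)} (hI : HomI I) :
    HomI (I.map (bc k K n)) := fun _ hf i =>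
  (mem_gr.1 (span_gr_le i (comp_mem_span hI hf i))).1

lemma hf_bc {I : Ideal (MvPolynomial (Fin n) k)} (hI : HomI I) (i : ℕ) :
    hf (I.map (bc k K n)) i = hf I i := by
  have h : gr (I.map (CurveBound.bc k K n)) i = Submodule.span K (CurveBound.bc k K n '' (gr I i)) := by
    apply le_antisymm _ (span_gr_le i)
    intro f hf
    have := comp_mem_span hI (mem_gr.1 hf).1 i
    rwa [comp_self (mem_gr.1 hf).2] at this
  unfold hf
  rw [h, hom_span (k := k), finrank_span, finrank_span]

end BaseChange
section Generic

variable {R : Type*} [CommRing R] {n : ℕ}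

/-- The generic linear form over the coefficient ring. -/
noncomputable def genL (a : R) (y : Fin n → R) : MvPolynomial (Fin n) R :=
  C a + ∑ j, X j * C (y j)

/-- The generic linear form without its `j`-th term. -/
noncomputable def genRest (a : R) (y : Fin n → R) (j : Fin n) : MvPolynomial (Fin n) R :=
  C a + ∑ i ∈ Finset.univ.erase j, X i * C (y i)

lemma genL_eq (a : R) (y : Fin n → R) (j : Fin n) :
    genL a y = genRest a y j + X j * C (y j) := by
  unfold genL genRest
  rw [← Finset.sum_erase_add _ _ (Finset.mem_univ j), add_assoc]

lemma reg_gen {I : Ideal R} {a : R} (y : Fin n → R) (ha : ∀ g, a * g ∈ I → g ∈ I)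
    {f : MvPolynomial (Fin n) R} (hf : genL a y * f ∈ I.map (C : R →+* MvPolynomial (Fin n) R)) :
    f ∈ I.map (C : R →+* MvPolynomial (Fin n) R) := by
  rw [mem_map_C_iff] at hf ⊢
  have key : ∀ N : ℕ, ∀ m : Fin n →₀ ℕ, m.degree = N → coeff m f ∈ I := by
    intro N
    induction N using Nat.strong_induction_on with
    | _ N ih =>
      intro m hm
      apply ha
      have h := hf m
      rw [genL, add_mul, coeff_add, coeff_C_mul, Finset.sum_mul, coeff_sum] at h
      refine (I.add_mem_iff_left ?_).1 h
      refine I.sum_mem fun j _ => ?_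
      rw [mul_assoc, coeff_X_mul']
      split_ifs with hj
      · rw [coeff_C_mul]
        refine I.mul_mem_left _ (ih _ ?_ _ rfl)
        have h1 : Finsupp.single j 1 + (m - Finsupp.single j 1) = m := by
          apply add_tsub_cancel_of_le
          rw [Finsupp.single_le_iff]
          exact Nat.one_le_iff_ne_zero.2 (Finsupp.mem_support_iff.1 hj)
        have h2 := congrArg Finsupp.degree h1
        rw [map_add, Finsupp.degree_single] at h2
        omega
      · exact I.zero_mem
  exact fun m => key _ m rfl

/-- Substitute `0` for the `j`-th variable. -/
noncomputable def killV (j : Fin n) : MvPolynomial (Fin n) R →+* MvPolynomial (Fin n) R :=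
  eval₂Hom C (fun i => if i = j then 0 else X i)

lemma killV_C (j : Fin n) (a : R) : killV j (C a) = C a := by simp [killV]

lemma killV_X {i j : Fin n} (h : i ≠ j) : killV (R := R) j (X i) = X i := by simp [killV, h]

lemma killV_rest (a : R) (y : Fin n → R) (j : Fin n) :
    killV j (genRest a y j) = genRest a y j := by
  unfold genRest
  rw [map_add, killV_C, map_sum]
  congr 1
  refine Finset.sum_congr rfl fun i hi => ?_
  rw [map_mul, killV_C, killV_X (Finset.ne_of_mem_erase hi)]

lemma elim (a : R) (y : Fin n → R) (j : Fin n) (g : MvPolynomial (Fin n) R) :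
    ∃ N : ℕ, ∃ h : MvPolynomial (Fin n) R,
      C (y j) ^ N * g - killV j h ∈ Ideal.span {genL a y} := by
  induction g using MvPolynomial.induction_on with
  | C b => exact ⟨0, C b, by simp [killV_C]⟩
  | add p q hp hq =>
    obtain ⟨N, h, hN⟩ := hp
    obtain ⟨M, h', hM⟩ := hq
    refine ⟨N + M, C (y j) ^ M * h + C (y j) ^ N * h', ?_⟩
    rw [map_add, map_mul, map_mul, map_pow, map_pow, killV_C]
    have := add_mem (Ideal.mul_mem_left _ (C (y j) ^ M) hN) (Ideal.mul_mem_left _ (C (y j) ^ N) hM)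
    convert this using 1
    ring
  | mul_X p i hp =>
    obtain ⟨N, h, hN⟩ := hp
    by_cases hij : i = j
    · subst hij
      refine ⟨N + 1, - h * genRest a y i, ?_⟩
      rw [map_mul, map_neg, killV_rest]
      have h1 : C (y i) ^ N * p * genL a y ∈ Ideal.span {genL a y} :=
        Ideal.mul_mem_left _ _ (Ideal.mem_span_singleton_self _)
      have := sub_mem h1 (Ideal.mul_mem_left _ (genRest a y i) hN)
      convert this using 1
      rw [genL_eq a y i]
      ring
    · refine ⟨N, h * X i, ?_⟩
      rw [map_mul, killV_X hij]
      have := Ideal.mul_mem_left _ (X i) hN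
      convert this using 1
      ring

variable {F : Type*} [Field F] (ν : R →+* F)

/-- Solve the generic linear equation for the `j`-th variable. -/
noncomputable def solve (a : R) (y : Fin n → R) (j : Fin n) :
    MvPolynomial (Fin n) R →+* MvPolynomial (Fin n) F :=
  eval₂Hom (C.comp ν) (fun i => if i = j then
    - (C (ν (y j))⁻¹ * MvPolynomial.map ν (genRest a y j)) else X i)

lemma solve_C (a : R) (y : Fin n → R) (j : Fin n) (b : R) :
    solve ν a y j (C b) = C (ν b) := by simp [solve]

lemma solve_X (a : R) (y : Fin n → R) {i j : Fin n} (h : i ≠ j) :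
    solve ν a y j (X i) = X i := by simp [solve, h]

lemma solve_kill (a : R) (y : Fin n → R) (j : Fin n) (h : MvPolynomial (Fin n) R) :
    solve ν a y j (killV j h) = MvPolynomial.map ν (killV j h) := by
  induction h using MvPolynomial.induction_on with
  | C b => simp [killV_C, solve_C]
  | add p q hp hq => simp only [map_add, hp, hq]
  | mul_X p i hp =>
    rw [map_mul, map_mul, map_mul, hp]
    congr 1
    by_cases hij : i = j
    · simp [killV, hij]
    · rw [killV_X hij, solve_X _ _ _ hij, map_X]

lemma solve_genL (a : R) (y : Fin n → R) {j : Fin n} (hj : ν (y j) ≠ 0) :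
    solve ν a y j (genL a y) = 0 := by
  rw [genL_eq a y j, map_add, map_mul, solve_C, ← killV_rest, solve_kill, killV_rest]
  have : solve ν a y j (X j) = - (C (ν (y j))⁻¹ * MvPolynomial.map ν (genRest a y j)) := by
    simp [solve]
  rw [this]
  have h2 : (C (ν (y j))⁻¹ * C (ν (y j)) : MvPolynomial (Fin n) F) = 1 := by
    rw [← C_mul, inv_mul_cancel₀ hj, C_1]
  linear_combination (- MvPolynomial.map ν (genRest a y j)) * h2

/-- Ideal of the generic hyperplane section. -/
noncomputable def genI (P : Ideal R) (a : R) (y : Fin n → R) : Ideal (MvPolynomial (Fin n) R) :=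
  P.map (C : R →+* MvPolynomial (Fin n) R) ⊔ Ideal.span {genL a y}

lemma solve_genI {P : Ideal R} (hν : RingHom.ker ν = P) (a : R) (y : Fin n → R) {j : Fin n}
    (hj : y j ∉ P) {g : MvPolynomial (Fin n) R} (hg : g ∈ genI P a y) : solve ν a y j g = 0 := by
  have h : genI P a y ≤ RingHom.ker (solve ν a y j) := by
    refine sup_le ?_ ?_
    · rw [Ideal.map_le_iff_le_comap]
      intro b hb
      rw [Ideal.mem_comap, RingHom.mem_ker, solve_C]
      rw [← hν, RingHom.mem_ker] at hb
      rw [hb, C_0]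
    · rw [Ideal.span_singleton_le_iff_mem, RingHom.mem_ker]
      apply solve_genL
      rwa [← hν, RingHom.mem_ker] at hj
  exact h hg

lemma of_solve {P : Ideal R} (hν : RingHom.ker ν = P) (a : R) (y : Fin n → R) {j : Fin n}
    (hj : y j ∉ P) {g : MvPolynomial (Fin n) R} (hg : solve ν a y j g = 0) :
    ∃ N : ℕ, C (y j) ^ N * g ∈ genI P a y := by
  obtain ⟨N, h, hN⟩ := elim a y j g
  have h1 : C (y j) ^ N * g - killV j h ∈ genI P a y :=
    (le_sup_right : Ideal.span {genL a y} ≤ genI P a y) hN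
  have h2 := solve_genI ν hν a y hj h1
  rw [map_sub, map_mul, hg, mul_zero, zero_sub, neg_eq_zero, solve_kill] at h2
  have h3 : killV j h ∈ P.map (C : R →+* MvPolynomial (Fin n) R) := by
    rw [← hν, ← ker_map]; exact h2
  refine ⟨N, ?_⟩
  have := add_mem h1 ((le_sup_left : P.map (C : R →+* MvPolynomial (Fin n) R) ≤ genI P a y) h3)
  simpa using this

/-- If `g` vanishes for one chart then some power of all the `y j` kills it. -/
lemma of_solve_all {P : Ideal R} (hν : RingHom.ker ν = P) (a : R) (y : Fin n → R) {j : Fin n}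
    (hj : y j ∉ P) {g : MvPolynomial (Fin n) R} (hg : solve ν a y j g = 0) :
    ∃ N : ℕ, ∀ i, C (y i) ^ N * g ∈ genI P a y := by
  obtain ⟨N, hN⟩ := of_solve ν hν a y hj hg
  have h : ∀ i, ∃ M : ℕ, C (y i) ^ M * g ∈ genI P a y := by
    intro i
    by_cases hi : y i ∈ P
    · refine ⟨1, ?_⟩
      rw [pow_one]
      exact Ideal.mul_mem_right _ _
        ((le_sup_left : P.map (C : R →+* MvPolynomial (Fin n) R) ≤ genI P a y)
          (Ideal.mem_map_of_mem _ hi))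
    · apply of_solve ν hν a y hi
      have h2 := solve_genI ν hν a y hi hN
      rw [map_mul, map_pow, solve_C] at h2
      rcases mul_eq_zero.1 h2 with h3 | h3
      · exfalso
        have h5 := eq_zero_of_pow_eq_zero h3
        rw [C_eq_zero] at h5
        exact hj (hν ▸ (RingHom.mem_ker.2 h5))
      · exact h3
  choose M hM using h
  refine ⟨∑ i, M i, fun i => ?_⟩
  obtain ⟨c, hc⟩ := Nat.exists_eq_add_of_le
    (Finset.single_le_sum (f := M) (fun _ _ => Nat.zero_le _) (Finset.mem_univ i))
  rw [hc, add_comm, pow_add, mul_assoc]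
  exact Ideal.mul_mem_left _ _ (hM i)

end Generic
section GenericSection

set_option linter.unusedSectionVars false

variable {k K : Type*} [Field k] [Field K] {n : ℕ} [Algebra (MvPolynomial (Fin n) k) K]
  [IsFractionRing (MvPolynomial (Fin n) k) K] [Algebra k K]
  [IsScalarTower k (MvPolynomial (Fin n) k) K]

/-- `k[x][u] → k(u)[x]`. -/
noncomputable def Phi (k K : Type*) [Field k] [Field K] (n : ℕ)
    [Algebra (MvPolynomial (Fin n) k) K] :
    MvPolynomial (Fin n) (MvPolynomial (Fin n) k) →+* MvPolynomial (Fin n) K :=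
  (MvPolynomial.map (algebraMap (MvPolynomial (Fin n) k) K)).comp
    (commAlgEquiv k (Fin n) (Fin n) : _ →+* _)

/-- `k[u] → k[x][u]`. -/
noncomputable def sig (q : MvPolynomial (Fin n) k) :
    MvPolynomial (Fin n) (MvPolynomial (Fin n) k) :=
  (commAlgEquiv k (Fin n) (Fin n)).symm (C q)

lemma Phi_inj : Function.Injective (Phi k K n) := by
  unfold Phi
  rw [RingHom.coe_comp]
  exact (map_injective _ (IsFractionRing.injective _ K)).comp
    (commAlgEquiv k (Fin n) (Fin n)).injective

lemma Phi_sig (q : MvPolynomial (Fin n) k) :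
    Phi k K n (sig q) = C (algebraMap _ K q) := by
  simp [Phi, sig]

lemma Phi_C (p : MvPolynomial (Fin n) k) : Phi k K n (C p) = bc k K n p := by
  simp only [Phi, RingHom.comp_apply, RingHom.coe_coe, commAlgEquiv_C, bc, MvPolynomial.map_map]
  congr 1
  rw [IsScalarTower.algebraMap_eq k (MvPolynomial (Fin n) k) K]
  rfl

lemma Phi_X (j : Fin n) : Phi k K n (X j) = C (algebraMap (MvPolynomial (Fin n) k) K (X j)) := by
  simp [Phi]

lemma Phi_CX (j : Fin n) : Phi k K n (C (X j)) = X j := by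
  rw [Phi_C]; simp

/-- The generic linear form through the linear form `a`. -/
noncomputable def gl (K : Type*) [Field K] [Algebra (MvPolynomial (Fin n) k) K]
    (a : MvPolynomial (Fin n) k) : MvPolynomial (Fin n) K := Phi k K n (genL a X)

lemma gl_hom {a : MvPolynomial (Fin n) k} (ha : a.IsHomogeneous 1) : (gl K a).IsHomogeneous 1 := by
  unfold gl genL
  rw [map_add, Phi_C, map_sum]
  refine (ha.map _).add (IsHomogeneous.sum _ _ _ fun j _ => ?_)
  rw [map_mul, Phi_CX, Phi_X]
  simpa using (isHomogeneous_C (Fin n) _).mul (isHomogeneous_X K j)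

lemma clear (f : MvPolynomial (Fin n) K) : ∃ q : MvPolynomial (Fin n) k, q ≠ 0 ∧
    ∃ g, C (algebraMap _ K q) * f = Phi k K n g := by
  induction f using MvPolynomial.induction_on with
  | C c =>
    obtain ⟨x, y, hy, rfl⟩ := IsFractionRing.div_surjective (A := MvPolynomial (Fin n) k) c
    refine ⟨y, nonZeroDivisors.ne_zero hy, sig x, ?_⟩
    rw [Phi_sig, ← C_mul]
    congr 1
    have : algebraMap (MvPolynomial (Fin n) k) K y ≠ 0 :=
      IsFractionRing.to_map_ne_zero_of_mem_nonZeroDivisors hy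
    field_simp
  | add f f' hf hf' =>
    obtain ⟨q, hq, g, hg⟩ := hf
    obtain ⟨q', hq', g', hg'⟩ := hf'
    refine ⟨q * q', mul_ne_zero hq hq', sig q' * g + sig q * g', ?_⟩
    simp only [map_add, map_mul, ← hg, ← hg', Phi_sig]
    ring
  | mul_X f j hf =>
    obtain ⟨q, hq, g, hg⟩ := hf
    refine ⟨q, hq, g * C (X j), ?_⟩
    rw [map_mul, Phi_CX, ← hg, mul_assoc]

lemma clear_ideal {b : Ideal (MvPolynomial (Fin n) (MvPolynomial (Fin n) k))}
    {f : MvPolynomial (Fin n) K} (hf : f ∈ b.map (Phi k K n)) :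
    ∃ q : MvPolynomial (Fin n) k, q ≠ 0 ∧
    ∃ g ∈ b, C (algebraMap _ K q) * f = Phi k K n g := by
  induction hf using Submodule.span_induction with
  | mem x hx =>
    obtain ⟨g, hg, rfl⟩ := hx
    exact ⟨1, one_ne_zero, g, hg, by simp⟩
  | zero => exact ⟨1, one_ne_zero, 0, zero_mem _, by simp⟩
  | add f f' _ _ hf hf' =>
    obtain ⟨q, hq, g, hgb, hg⟩ := hf
    obtain ⟨q', hq', g', hgb', hg'⟩ := hf'
    refine ⟨q * q', mul_ne_zero hq hq', sig q' * g + sig q * g',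
      add_mem (b.mul_mem_left _ hgb) (b.mul_mem_left _ hgb'), ?_⟩
    simp only [map_add, map_mul, ← hg, ← hg', Phi_sig]
    ring
  | smul r f _ hf =>
    obtain ⟨q, hq, g, hgb, hg⟩ := hf
    obtain ⟨q', hq', g', hg'⟩ := clear (k := k) r
    refine ⟨q * q', mul_ne_zero hq hq', g' * g, b.mul_mem_left _ hgb, ?_⟩
    simp only [map_mul, ← hg, ← hg', smul_eq_mul]
    ring

lemma mem_of_C_mul {I : Ideal (MvPolynomial (Fin n) K)} {c : K} (hc : c ≠ 0)
    {f : MvPolynomial (Fin n) K} (h : C c * f ∈ I) : f ∈ I := by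
  have := I.mul_mem_left (C c⁻¹) h
  rwa [← mul_assoc, ← C_mul, inv_mul_cancel₀ hc, C_1, one_mul] at this

lemma alg_ne {q : MvPolynomial (Fin n) k} (hq : q ≠ 0) : algebraMap _ K q ≠ 0 := by
  rwa [Ne, map_eq_zero_iff _ (IsFractionRing.injective _ K)]

lemma map_Phi_C (I : Ideal (MvPolynomial (Fin n) k)) :
    (I.map (C : _ →+* MvPolynomial (Fin n) (MvPolynomial (Fin n) k))).map (Phi k K n) =
      I.map (bc k K n) := by
  rw [Ideal.map_map]
  congr 1
  exact RingHom.ext fun p => Phi_C p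

lemma map_Phi_gen (P : Ideal (MvPolynomial (Fin n) k)) (a : MvPolynomial (Fin n) k) :
    (genI P a X).map (Phi k K n) = P.map (bc k K n) ⊔ Ideal.span {gl K a} := by
  unfold genI
  rw [Ideal.map_sup, map_Phi_C, Ideal.map_span, Set.image_singleton]
  rfl

lemma reg_gl {I : Ideal (MvPolynomial (Fin n) k)} {a : MvPolynomial (Fin n) k} (ha : Reg I a) :
    Reg (I.map (bc k K n)) (gl K a) := by
  intro f hf
  rw [← map_Phi_C] at hf ⊢
  obtain ⟨q, hq, g, hg, hqg⟩ := clear_ideal hf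
  obtain ⟨q', hq', f', hf'⟩ := clear (k := k) f
  have h1 : genL a X * (sig q * f') = sig q' * g := by
    apply Phi_inj (K := K)
    rw [map_mul, map_mul, map_mul, ← hqg, ← hf', Phi_sig, Phi_sig]
    unfold gl
    ring
  have h2 : genL a X * (sig q * f') ∈
      I.map (C : _ →+* MvPolynomial (Fin n) (MvPolynomial (Fin n) k)) := by
    rw [h1]; exact Ideal.mul_mem_left _ _ hg
  have h3 := Ideal.mem_map_of_mem (Phi k K n) (reg_gen X ha h2)
  rw [map_mul, ← hf', Phi_sig] at h3
  exact mem_of_C_mul (alg_ne hq') (mem_of_C_mul (alg_ne hq) h3)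

lemma prime_sec {P : Ideal (MvPolynomial (Fin n) k)} (hP : P.IsPrime) {j : Fin n} (hj : X j ∉ P)
    (a : MvPolynomial (Fin n) k) (h1 : 1 ∉ sat (P.map (bc k K n) ⊔ Ideal.span {gl K a})) :
    (sat (P.map (bc k K n) ⊔ Ideal.span {gl K a})).IsPrime := by
  rw [← map_Phi_gen] at h1 ⊢
  set Q := sat ((genI P a X).map (Phi k K n)) with hQ
  let ν : MvPolynomial (Fin n) k →+* FractionRing (MvPolynomial (Fin n) k ⧸ P) :=
    (algebraMap _ _).comp (Ideal.Quotient.mk P)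
  have hν : RingHom.ker ν = P := by
    rw [RingHom.ker_comp_of_injective _ (IsFractionRing.injective _ _), Ideal.mk_ker]
  have back : ∀ g, solve ν a X j g = 0 → Phi k K n g ∈ Q := by
    intro g hg
    obtain ⟨N, hN⟩ := of_solve_all ν hν a X hj hg
    refine ⟨N, fun i => ?_⟩
    have := Ideal.mem_map_of_mem (Phi k K n) (hN i)
    rwa [map_mul, map_pow, Phi_CX] at this
  have sig0 : ∀ q : MvPolynomial (Fin n) k, q ≠ 0 → solve ν a X j (sig q) ≠ 0 := by
    intro q hq h
    have h2 := back _ h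
    rw [Phi_sig] at h2
    exact h1 (mem_of_C_mul (alg_ne hq) (by rwa [mul_one]))
  refine ⟨fun h => h1 (h ▸ Submodule.mem_top), ?_⟩
  intro f g hfg
  obtain ⟨q, hq, f', hf'⟩ := clear (k := k) f
  obtain ⟨q', hq', g', hg'⟩ := clear (k := k) g
  obtain ⟨N, hN⟩ := hfg
  obtain ⟨q'', hq'', h, hh, hqh⟩ := clear_ideal (hN j)
  have e1 : sig q'' * C (X j) ^ N * (f' * g') = sig q * sig q' * h := by
    apply Phi_inj (K := K)
    simp only [map_mul, map_pow, ← hqh, ← hf', ← hg', Phi_sig, Phi_CX]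
    ring
  have e2 := congrArg (solve ν a X j) e1
  have hh0 := solve_genI ν hν a X hj hh
  rw [map_mul _ _ h, hh0, mul_zero, map_mul, map_mul, map_mul, map_pow, solve_C] at e2
  have hxj : ν (X j) ≠ 0 := fun h => hj (hν ▸ (RingHom.mem_ker.2 h))
  have e3 : solve ν a X j f' * solve ν a X j g' = 0 := by
    refine (mul_eq_zero.1 e2).resolve_left (mul_ne_zero (sig0 _ hq'') (pow_ne_zero _ ?_))
    rwa [Ne, C_eq_zero]
  rcases mul_eq_zero.1 e3 with h0 | h0
  · left
    have := back _ h0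
    rw [← hf'] at this
    exact mem_of_C_mul (alg_ne hq) this
  · right
    have := back _ h0
    rw [← hg'] at this
    exact mem_of_C_mul (alg_ne hq') this

end GenericSection
section Final

variable {n : ℕ}

lemma exists_not_of_growth {k : Type*} [Field k] {I : Ideal (MvPolynomial (Fin n) k)} {a : ℕ}
    {c : ℤ} (ha : 0 < a) (h : ∃ N : ℕ, ∀ i ≥ N, hf I i = a * i + c) :
    (1 : MvPolynomial (Fin n) k) ∉ I := by
  obtain ⟨N, hN⟩ := h
  by_cases h0 : hf I N = 0
  · apply one_not_mem_of_hf (i := N + 1)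
    have h1 := hN N le_rfl
    have h2 := hN (N + 1) (by omega)
    push_cast at h2
    have : (0 : ℤ) < a := by exact_mod_cast ha
    intro h3
    linarith
  · exact one_not_mem_of_hf h0

lemma final_bound {P J : Ideal (MvPolynomial (Fin n) ℂ)} (hPh : HomI P) (hP : P.IsPrime)
    {s : ℕ} (hs : 1 ≤ s) {c : ℤ} {l : MvPolynomial (Fin n) ℂ} (hl : l.IsHomogeneous 1)
    (hl0 : l ≠ 0) (hlr : Reg P l)
    (hsec : ∃ N : ℕ, ∀ i ≥ N, hf (P ⊔ Ideal.span {l}) i = s * i + c)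
    (hJh : HomI J) (hPJ : P ≤ J) {d : ℕ} (hd : 0 < d) {e : ℤ}
    (hcur : ∃ N : ℕ, ∀ i ≥ N, hf J i = d * i + e) :
    2 * (s : ℤ) * (1 - e) ≤ (d : ℤ) ^ 2 - d * (2 * c + s) + 2 * s ^ 5 := by
  have h1P : (1 : MvPolynomial (Fin n) ℂ) ∉ P := fun h =>
    hP.ne_top ((Ideal.eq_top_iff_one _).2 h)
  obtain ⟨j, hj⟩ : ∃ j, (X j : MvPolynomial (Fin n) ℂ) ∉ P := by
    by_contra hcon
    push Not at hcon
    have h1 : l ^ (n + 2) * 1 ∈ P := by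
      apply pigeon (N := 1) (m := 1 * (n + 2)) (fun j => ?_) (hl.pow _) (by omega)
      simpa using hcon j
    rw [mul_one] at h1
    have h2 := hP.mem_of_pow_mem _ h1
    exact h1P (hlr 1 (by rwa [mul_one]))
  have hPsat : IsSat P := fun f hf => (hP.mem_or_mem (hf j)).resolve_left hj
  set J' := sat J with hJ'
  have hJ'h : HomI J' := hJh.sat
  have hPJ' : P ≤ J' := hPJ.trans (le_sat J)
  have hcur' : ∃ N : ℕ, ∀ i ≥ N, hf J' i = d * i + e := by
    obtain ⟨N, hN⟩ := hcur
    obtain ⟨M, hM⟩ := sat_eventually hJh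
    exact ⟨N + M, fun i hi => by rw [hM i (by omega), hN i (by omega)]⟩
  obtain ⟨a, ha, haP, haJ⟩ := exists_reg hPsat (isSat_sat J)
  let K := FractionRing (MvPolynomial (Fin n) ℂ)
  haveI : Infinite K := Infinite.of_injective _ (FaithfulSMul.algebraMap_injective ℂ K)
  set PK := P.map (bc ℂ K n) with hPK
  set JK := J'.map (bc ℂ K n) with hJK
  have hPKh : HomI PK := hPh.bc
  have hJKh : HomI JK := hJ'h.bc
  have hPKf : ∀ i, hf PK i = hf P i := hf_bc hPh
  have hJKf : ∀ i, hf JK i = hf J' i := hf_bc hJ'h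
  set L : MvPolynomial (Fin n) K := gl K a with hL
  have hLh : L.IsHomogeneous 1 := gl_hom ha
  have hLP : Reg PK L := reg_gl haP
  have hLJ : Reg JK L := reg_gl haJ
  have h1JK : (1 : MvPolynomial (Fin n) K) ∉ JK := by
    apply exists_not_of_growth (a := d) (c := e) hd
    obtain ⟨N, hN⟩ := hcur'
    exact ⟨N, fun i hi => by rw [hJKf, hN i hi]⟩
  have hL0 : L ≠ 0 := reg_ne_zero h1JK hLJ
  -- the generic section of the surface
  have hAf : ∃ N : ℕ, ∀ i ≥ N, hf (PK ⊔ Ideal.span {L}) i = s * i + c := by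
    obtain ⟨N, hN⟩ := hsec
    refine ⟨N + 1, fun i hi => ?_⟩
    obtain ⟨m, rfl⟩ : ∃ m, i = m + 1 := ⟨i - 1, by omega⟩
    rw [hf_sup hPKh hLh hLP hL0, hPKf, hPKf, ← hf_sup hPh hl hlr hl0, hN _ (by omega)]
  have hAh : HomI (PK ⊔ Ideal.span {L}) := hPKh.addSpan hLh
  set Q := sat (PK ⊔ Ideal.span {L}) with hQ
  have hQf : ∃ N : ℕ, ∀ i ≥ N, hf Q i = s * i + c := by
    obtain ⟨N, hN⟩ := hAf
    obtain ⟨M, hM⟩ := sat_eventually hAh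
    exact ⟨N + M, fun i hi => by rw [hM i (by omega), hN i (by omega)]⟩
  have h1Q : (1 : MvPolynomial (Fin n) K) ∉ Q := exists_not_of_growth (by omega) hQf
  have hQp : Q.IsPrime := prime_sec hP hj a h1Q
  -- the generic section of the curve
  have hBh : HomI (JK ⊔ Ideal.span {L}) := hJKh.addSpan hLh
  have hBf : ∃ N : ℕ, ∀ i ≥ N, hf (JK ⊔ Ideal.span {L}) i = (d : ℤ) := by
    obtain ⟨N, hN⟩ := hcur'
    refine ⟨N + 1, fun i hi => ?_⟩
    obtain ⟨m, rfl⟩ : ∃ m, i = m + 1 := ⟨i - 1, by omega⟩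
    rw [hf_sup hJKh hLh hLJ hL0, hJKf, hJKf, hN _ (by omega), hN _ (by omega)]
    push_cast
    ring
  set G := sat (JK ⊔ Ideal.span {L}) with hG
  have hGf : ∃ N : ℕ, ∀ i ≥ N, hf G i = (d : ℤ) := by
    obtain ⟨N, hN⟩ := hBf
    obtain ⟨M, hM⟩ := sat_eventually hBh
    exact ⟨N + M, fun i hi => by rw [hM i (by omega), hN i (by omega)]⟩
  have hQG : Q ≤ G := sat_mono (sup_le_sup_right (Ideal.map_mono hPJ') _)
  obtain ⟨M, hM⟩ := main_curve hQp hAh.sat (isSat_sat _) hQf hs hQG hBh.sat (isSat_sat _) hGf hd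
  obtain ⟨N, hN⟩ := hcur'
  have h1 := hM (M + N) (by omega)
  have h2 := hf_sum hJKh hLh hLJ hL0 (M + N)
  rw [hJKf, hN _ (by omega)] at h2
  have h3 : ∑ i ∈ Finset.range (M + N + 1), hf G i ≤
      ∑ i ∈ Finset.range (M + N + 1), hf (JK ⊔ Ideal.span {L}) i :=
    Finset.sum_le_sum fun i _ => hf_anti (le_sat _) i
  rw [← h2] at h3
  refine le_trans ?_ h1
  apply mul_le_mul_of_nonneg_left _ (by positivity)
  linarith

end Final

end CurveBound

/-- Proposition (nSintegra): let `S ⊂ ℙʳ` be a reduced, irreducible projective surface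
of degree `s ≥ 1` and sectional genus `π`, cut out by the prime homogeneous ideal `P`;
the degree and sectional genus are read off a hyperplane section `S ∩ {ℓ = 0}` by a
linear form `ℓ` which is a nonzerodivisor on the homogeneous coordinate ring of `S`
(its Hilbert polynomial is `s·i + 1 − π`, and this is independent of the choice of such
an `ℓ`).  Let `C ⊂ S` be a closed subscheme of dimension 1 and degree `d > 0`, cut out
by a homogeneous ideal `J ⊇ P`, with arithmetic genus `p = 1 − χ(O_C)` (Hilbert
polynomial `d·i + 1 − p`).  Then `p_a(C) ≤ d²/(2s) + (d/(2s))(2π − 2 − s) + s⁴`. -/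
theorem stmt_12 (r : ℕ) (P : Ideal (MvPolynomial (Fin (r + 1)) ℂ))
    (hPhom : P.IsHomogeneous (MvPolynomial.homogeneousSubmodule (Fin (r + 1)) ℂ))
    (hPprime : P.IsPrime)
    (s : ℕ) (hs : 1 ≤ s) (π : ℤ)
    (ℓ : MvPolynomial (Fin (r + 1)) ℂ)
    (hℓ : ℓ ∈ MvPolynomial.homogeneousSubmodule (Fin (r + 1)) ℂ 1) (hℓ0 : ℓ ≠ 0)
    (hℓreg : ∀ f : MvPolynomial (Fin (r + 1)) ℂ, ℓ * f ∈ P → f ∈ P)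
    (hsection : ∃ N : ℕ, ∀ i ≥ N, (hilb (P ⊔ Ideal.span {ℓ}) i : ℤ) = s * i + (1 - π))
    (J : Ideal (MvPolynomial (Fin (r + 1)) ℂ))
    (hJhom : J.IsHomogeneous (MvPolynomial.homogeneousSubmodule (Fin (r + 1)) ℂ))
    (hPJ : P ≤ J)
    (d : ℕ) (hd : 0 < d) (p : ℤ)
    (hcurve : ∃ N : ℕ, ∀ i ≥ N, (hilb J i : ℤ) = d * i + (1 - p)) :
    (p : ℚ) ≤ (d : ℚ) ^ 2 / (2 * s) + (d : ℚ) / (2 * s) * (2 * (π : ℚ) - 2 - s)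
      + (s : ℚ) ^ 4 := by
  obtain ⟨N, hN⟩ := hsection
  obtain ⟨M, hM⟩ := hcurve
  have h := CurveBound.final_bound (c := 1 - π) (e := 1 - p) (CurveBound.homI_of hPhom) hPprime hs
    hℓ hℓ0 hℓreg ⟨N, fun i hi => by rw [← CurveBound.hilb_eq, hN i hi]⟩
    (CurveBound.homI_of hJhom) hPJ hd ⟨M, fun i hi => by rw [← CurveBound.hilb_eq, hM i hi]⟩
  have hq : 2 * (s : ℚ) * (1 - (1 - p)) ≤
      (d : ℚ) ^ 2 - d * (2 * (1 - π) + s) + 2 * s ^ 5 := by exact_mod_cast h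
  have hs0 : (0 : ℚ) < s := by exact_mod_cast hs
  have e : (d : ℚ) ^ 2 / (2 * s) + (d : ℚ) / (2 * s) * (2 * (π : ℚ) - 2 - s) + (s : ℚ) ^ 4 =
      ((d : ℚ) ^ 2 - d * (2 * (1 - π) + s) + 2 * s ^ 5) / (2 * s) := by
    field_simp
    ring
  rw [e, le_div_iff₀ (by positivity)]
  linarith
end
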